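/- arXiv:2201.01512 — 4 statements merged into one kernel-verified Lean document; each statement's English description precedes it below -/
import Mathlib

section
/- Let J satisfy (K1) and (K2), and fix r⁺ > 0, θ ∈ (0,1), ε > 0. Assume that T > 0 and L > 0 are such that θ·e^{−(r⁺+1)T}·∑_{i=1}^∞ (T^i/i!)·R_i(L) ≥ ε. Then the solution w of the semilinear toy problem ∂_t w = J ∗ w − w + r⁺·max(w − θ, 0) with initial datum w(0,x) = (θ+ε)·1_{(−L,L)}(x) satisfies sup_{x∈ℝ} w(T,x) ≤ θ. -/
open MeasureTheory Filter Set Asymptotics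

noncomputable section

/-- `convIter J n` is the (n+1)-fold convolution `J^{*(n+1)}` of `J` with itself:
`convIter J 0 = J` and `convIter J (n+1) = J ∗ convIter J n`. -/
def convIter (J : ℝ → ℝ) : ℕ → ℝ → ℝ
  | 0 => J
  | n + 1 => fun x => ∫ y, J y * convIter J n (x - y)

/-- `tailR J n L = R_{n+1}(L) = ∫_{|x| ≥ L} J^{*(n+1)}(x) dx`, the tail of the
`(n+1)`-fold convolution of `J`. -/
def tailR (J : ℝ → ℝ) (n : ℕ) (L : ℝ) : ℝ :=
  ∫ x in {x : ℝ | L ≤ |x|}, convIter J n x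

/-- The step initial datum `φ(x) = h · 1_{(-L,L)}(x)`. -/
def stepInit (h L : ℝ) : ℝ → ℝ :=
  Set.indicator (Set.Ioo (-L) L) (fun _ => h)

/-- Assumption (K1): `J` is nonnegative, even, integrable, of total mass 1. -/
def K1 (J : ℝ → ℝ) : Prop :=
  (∀ x, 0 ≤ J x) ∧ (∀ x, J (-x) = J x) ∧ Integrable J ∧ (∫ x, J x) = 1

/-- `u` is a bounded solution of `∂ₜ u = ∫ J(y)(u(t,x-y) - u(t,x)) dy + f(u)` for `t > 0`,
with initial datum `u0`. -/
def IsBddSol (J f : ℝ → ℝ) (u0 : ℝ → ℝ) (u : ℝ → ℝ → ℝ) : Prop :=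
  (∃ M, ∀ t x, 0 ≤ t → |u t x| ≤ M) ∧
  (∀ t, 0 ≤ t → Measurable fun x => u t x) ∧
  (∀ x, ContinuousOn (fun t => u t x) (Set.Ici 0)) ∧
  (∀ x, u 0 x = u0 x) ∧
  (∀ t x, 0 < t → HasDerivAt (fun s => u s x)
    ((∫ y, J y * (u t (x - y) - u t x)) + f (u t x)) t)

/-- Extinction at large times: `sup_x u(t,x) → 0` as `t → ∞`. -/
def Extinct (u : ℝ → ℝ → ℝ) : Prop :=
  Tendsto (fun t => ⨆ x, u t x) atTop (nhds 0)

/-- Propagation: `u(t,x) → 1` as `t → ∞`, locally uniformly in `x`. -/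
def Propagates (u : ℝ → ℝ → ℝ) : Prop :=
  TendstoLocallyUniformly (fun t x => u t x) (fun _ => (1 : ℝ)) atTop

/-- Assumption (F): `f` is Lipschitz, vanishes at `0, θ, 1`, positive on `(θ,1)`,
bistable (with positive integral) or ignition, and `f(u) ≥ rm (u - θ)` on `[0, δ]`. -/
def AssumptionF (f : ℝ → ℝ) (θ rm δ : ℝ) : Prop :=
  (∃ C : ℝ, 0 ≤ C ∧ ∀ u v : ℝ, |f u - f v| ≤ C * |u - v|) ∧
  f 0 = 0 ∧ f θ = 0 ∧ f 1 = 0 ∧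
  (∀ u ∈ Set.Ioo θ 1, 0 < f u) ∧
  (((∀ u ∈ Set.Ioo 0 θ, f u < 0) ∧ 0 < ∫ s in (0:ℝ)..1, f s) ∨
    (∀ u ∈ Set.Ioo 0 θ, f u = 0)) ∧
  0 < rm ∧ δ ∈ Set.Ioo θ 1 ∧
  (∀ u ∈ Set.Icc 0 δ, rm * (u - θ) ≤ f u)

/-- Assumption (K3): the Fourier transform of `J` satisfies
`Ĵ(ξ) = 1 - a |ξ|^β + o(|ξ|^β)` as `ξ → 0`. -/
def K3 (J : ℝ → ℝ) (a β : ℝ) : Prop :=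
  (fun ξ : ℝ => (∫ x : ℝ, Complex.exp (-((ξ : ℂ) * (x : ℂ)) * Complex.I) * (J x : ℂ))
      - ((1 - a * |ξ| ^ β : ℝ) : ℂ))
    =o[nhds (0:ℝ)] (fun ξ : ℝ => |ξ| ^ β)

lemma toy_comparison (E E' : ℝ → ℝ → ℝ) (T r B : ℝ) (hT : 0 < T) (hr : 0 < r) (hB : 0 ≤ B)
    (h0 : ∀ x, E 0 x ≤ 0) (hc : ∀ x, ContinuousOn (fun t => E t x) (Set.Icc 0 T))
    (hd : ∀ t x, t ∈ Set.Ioo 0 T → HasDerivAt (fun s => E s x) (E' t x) t)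
    (hbd : ∀ t x, t ∈ Set.Icc 0 T → E t x ≤ B)
    (hE' : ∀ t x b, t ∈ Set.Ioo 0 T → 0 ≤ b → (∀ y, E t y ≤ b) → E' t x ≤ (1 + r) * b) :
    ∀ x, E T x ≤ 0 := by
  have key : ∀ k : ℕ, ∀ t x, t ∈ Set.Icc 0 T →
      E t x ≤ B * (((1 + r) * t) ^ k / (Nat.factorial k : ℝ)) := by
    intro k
    induction k with
    | zero => intro t x ht; simpa using hbd t x ht
    | succ k ih =>
      intro t x ht
      have hder : ∀ s : ℝ, HasDerivAt
          (fun s => B * (((1 + r) * s) ^ (k+1) / (Nat.factorial (k+1) : ℝ)))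
          ((1 + r) * (B * (((1 + r) * s) ^ k / (Nat.factorial k : ℝ)))) s := by
        intro s
        have h1 : HasDerivAt (fun s : ℝ => (1 + r) * s) (1 + r) s := by
          simpa using (hasDerivAt_id s).const_mul (1 + r)
        have h2 := ((h1.pow (k+1)).div_const (Nat.factorial (k+1) : ℝ)).const_mul B
        refine HasDerivAt.congr_deriv (f := fun s => B * (((1 + r) * s) ^ (k+1) / (Nat.factorial (k+1) : ℝ))) h2 ?_
        have : (Nat.factorial k : ℝ) ≠ 0 := by positivity
        rw [Nat.factorial_succ]; push_cast; field_simp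
      have hanti : AntitoneOn
          (fun s => E s x - B * (((1 + r) * s) ^ (k+1) / (Nat.factorial (k+1) : ℝ)))
          (Set.Icc 0 T) := by
        apply antitoneOn_of_deriv_nonpos (convex_Icc 0 T)
        · exact (hc x).sub (fun s _ => (hder s).continuousAt.continuousWithinAt)
        · intro s hs
          rw [interior_Icc] at hs
          exact ((hd s x hs).sub (hder s)).differentiableAt.differentiableWithinAt
        · intro s hs
          rw [interior_Icc] at hs
          refine le_of_eq_of_le (HasDerivAt.deriv (f := fun s => E s x - B * (((1 + r) * s) ^ (k+1) / (Nat.factorial (k+1) : ℝ))) ((hd s x hs).sub (hder s))) ?_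
          have hs0 := hs.1
          have := hE' s x (B * (((1 + r) * s) ^ k / (Nat.factorial k : ℝ))) hs (by positivity)
            (fun y => ih s y ⟨hs.1.le, hs.2.le⟩)
          linarith
      have := hanti ⟨le_refl 0, hT.le⟩ ht ht.1
      simp only [mul_zero, ne_eq, Nat.add_eq_zero_iff, one_ne_zero, and_false, not_false_eq_true,
        zero_pow, zero_div, sub_zero] at this
      linarith [h0 x]
  intro x
  have hlim : Tendsto (fun k : ℕ => B * (((1 + r) * T) ^ k / (Nat.factorial k : ℝ))) atTop
      (nhds (B * 0)) :=
    (FloorSemiring.tendsto_pow_div_factorial_atTop ((1 + r) * T)).const_mul B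
  rw [mul_zero] at hlim
  exact ge_of_tendsto' hlim (fun k => key k T x ⟨hT.le, le_refl T⟩)

/-- iterates of convolution with J. -/
def toyIter (J : ℝ → ℝ) (g : ℝ → ℝ) : ℕ → ℝ → ℝ
  | 0 => g
  | n + 1 => fun x => ∫ y, J y * toyIter J g n (x - y)

lemma toy_int (J g : ℝ → ℝ) (hJ : Integrable J) (hg : Measurable g) (C : ℝ)
    (hC : ∀ x, |g x| ≤ C) (x : ℝ) : Integrable (fun y => J y * g (x - y)) := by
  apply hJ.mul_bdd (c := C)
  · exact (hg.comp (measurable_const.sub measurable_id)).aestronglyMeasurable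
  · exact Eventually.of_forall (fun y => by simpa using hC (x - y))

lemma toy_meas (J g : ℝ → ℝ) (hJ : Integrable J) (hg : Measurable g) :
    Measurable (fun x => ∫ y, J y * g (x - y)) := by
  obtain ⟨J', hJ', he⟩ := hJ.aestronglyMeasurable
  have : (fun x => ∫ y, J y * g (x - y)) = (fun x => ∫ y, J' y * g (x - y)) := by
    funext x
    apply integral_congr_ae
    filter_upwards [he] with y hy
    rw [hy]
  rw [this]
  have h2 : Measurable (fun p : ℝ × ℝ => J' p.2 * g (p.1 - p.2)) :=
    (hJ'.measurable.comp measurable_snd).mul (hg.comp (measurable_fst.sub measurable_snd))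
  exact (h2.stronglyMeasurable.integral_prod_right).measurable

lemma toy_conv_mono (J g : ℝ → ℝ) (hJ : K1 J) (hK2 : AntitoneOn J (Set.Ioi 0))
    (hg : Measurable g) (C : ℝ) (hC : ∀ x, |g x| ≤ C)
    (hmono : ∀ x y : ℝ, |x| ≤ |y| → g x ≤ g y) :
    ∀ x y : ℝ, |x| ≤ |y| → (∫ z, J z * g (x - z)) ≤ ∫ z, J z * g (y - z) := by
  obtain ⟨hJ0, hJe, hJi, hJ1⟩ := hJ
  have hge : ∀ x, g (-x) = g x := fun x =>
    le_antisymm (hmono _ _ (by simp)) (hmono _ _ (by simp))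
  have hJabs : ∀ x, J |x| = J x := by
    intro x
    rcases abs_choice x with h | h <;> rw [h]
    exact hJe x
  have heven : ∀ x, (∫ z, J z * g (-x - z)) = ∫ z, J z * g (x - z) := by
    intro x
    rw [← integral_neg_eq_self]
    congr 1; funext z
    rw [hJe, ← hge]; congr 2; ring
  -- main monotonicity
  have main : ∀ x y : ℝ, 0 ≤ x → x ≤ y →
      (∫ z, J z * g (x - z)) ≤ ∫ z, J z * g (y - z) := by
    intro x y hx hxy
    have form : ∀ a : ℝ, (∫ z, J z * g (a - z)) = ∫ z, J (a - z) * g z := by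
      intro a
      rw [← integral_sub_left_eq_self (fun z => J z * g (a - z)) volume a]
      simp
    have form2 : ∀ a b : ℝ, (∫ z, J z * g (a - z)) = ∫ z, J (b - z) * g (a + b - z) := by
      intro a b
      rw [← integral_sub_right_eq_self (fun z => J z * g (a - z)) b]
      congr 1; funext z
      rw [← hJe]; congr 2 <;> ring
    have hint : ∀ a : ℝ, Integrable (fun z => J (a - z) * g z) := by
      intro a
      apply (hJi.comp_sub_left a).mul_bdd (c := C) hg.aestronglyMeasurable
      exact Eventually.of_forall (fun y => by simpa using hC y)
    have hint2 : ∀ a : ℝ, Integrable (fun z => J (a - z) * g (x + y - z)) := by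
      intro a
      apply (hJi.comp_sub_left a).mul_bdd (c := C)
        (hg.comp (measurable_const.sub measurable_id)).aestronglyMeasurable
      exact Eventually.of_forall (fun z => by simpa using hC (x + y - z))
    have hf2 := form2 x y
    have hf2' := form2 y x
    rw [add_comm y x] at hf2'
    have hf1 := form x
    have hf1' := form y
    have hsum : 0 ≤ ∫ z, ((J (y - z) * g z - J (x - z) * g z)
        + (J (x - z) * g (x + y - z) - J (y - z) * g (x + y - z))) := by
      apply integral_nonneg_of_ae
      have hx' : ∀ᵐ z : ℝ, z ≠ x := Measure.ae_ne volume x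
      have hy' : ∀ᵐ z : ℝ, z ≠ y := Measure.ae_ne volume y
      filter_upwards [hx', hy'] with z hzx hzy
      have e : (J (y - z) * g z - J (x - z) * g z)
        + (J (x - z) * g (x + y - z) - J (y - z) * g (x + y - z))
        = (J (x - z) - J (y - z)) * (g (x + y - z) - g z) := by ring
      simp only [Pi.zero_apply]
      rw [e]
      have px : 0 < |x - z| := abs_pos.2 (sub_ne_zero.2 hzx.symm)
      have py : 0 < |y - z| := abs_pos.2 (sub_ne_zero.2 hzy.symm)
      rcases le_total (2 * z) (x + y) with h | h
      · have a1 : |x - z| ≤ |y - z| := sq_le_sq.1 (by nlinarith)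
        have a2 : |z| ≤ |x + y - z| := sq_le_sq.1 (by nlinarith)
        have b1 := hK2 px py a1
        rw [hJabs, hJabs] at b1
        exact mul_nonneg (by linarith) (by linarith [hmono _ _ a2])
      · have a1 : |y - z| ≤ |x - z| := sq_le_sq.1 (by nlinarith)
        have a2 : |x + y - z| ≤ |z| := sq_le_sq.1 (by nlinarith)
        have b1 := hK2 py px a1
        rw [hJabs, hJabs] at b1
        exact mul_nonneg_of_nonpos_of_nonpos (by linarith) (by linarith [hmono _ _ a2])
    have i1 : Integrable (fun z => J (y - z) * g z - J (x - z) * g z) := (hint y).sub (hint x)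
    have i2 : Integrable (fun z => J (x - z) * g (x + y - z) - J (y - z) * g (x + y - z)) :=
      (hint2 x).sub (hint2 y)
    rw [integral_add i1 i2,
      integral_sub (hint y) (hint x), integral_sub (hint2 x) (hint2 y)] at hsum
    linarith
  have habs : ∀ x, (∫ z, J z * g (|x| - z)) = ∫ z, J z * g (x - z) := by
    intro x
    rcases abs_choice x with h | h <;> rw [h]
    exact heven x
  intro x y hxy
  rw [← habs x, ← habs y]
  exact main _ _ (abs_nonneg x) hxy

lemma toy_convIter_int (J : ℝ → ℝ) (hJ : Integrable J) (n : ℕ) : Integrable (convIter J n) := by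
  induction n with
  | zero => exact hJ
  | succ n ih => exact hJ.integrable_convolution (ContinuousLinearMap.mul ℝ ℝ) ih

lemma toy_assoc (J g : ℝ → ℝ) (hJ : Integrable J) (hg : Measurable g) (C : ℝ)
    (hC : ∀ x, |g x| ≤ C) (n : ℕ) :
    ∀ x, toyIter J g (n + 1) x = ∫ y, convIter J n y * g (x - y) := by
  induction n with
  | zero => intro x; rfl
  | succ n ih =>
    intro x
    have h1 : toyIter J g (n + 1 + 1) x =
        ∫ y, ∫ z, J y * convIter J n (z - y) * g (x - z) := by
      change (∫ y, J y * toyIter J g (n + 1) (x - y)) = _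
      congr 1; funext y
      rw [ih, ← integral_const_mul,
        ← integral_sub_right_eq_self _ y]
      congr 1; funext z
      rw [mul_assoc]; congr 3; ring
    rw [h1, integral_integral_swap]
    · congr 1; funext z
      rw [integral_mul_const]; rfl
    · have h2 : Integrable (fun p : ℝ × ℝ => J p.2 * convIter J n (p.1 - p.2))
          (volume.prod volume) :=
        hJ.convolution_integrand (ContinuousLinearMap.mul ℝ ℝ) (toy_convIter_int J hJ n)
      have h3 : Integrable (fun p : ℝ × ℝ => J p.2 * convIter J n (p.1 - p.2) * g (x - p.1))
          (volume.prod volume) := by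
        apply h2.mul_bdd (c := C)
          (hg.comp (measurable_const.sub measurable_fst)).aestronglyMeasurable
        exact Eventually.of_forall (fun z => by simpa using hC (x - z.1))
      exact h3.swap

/-- outer indicator. -/
def toyOut (L : ℝ) : ℝ → ℝ := Set.indicator {x : ℝ | L ≤ |x|} (fun _ => 1)

lemma toy_out_props (J : ℝ → ℝ) (L : ℝ) (hJ : K1 J) (hK2 : AntitoneOn J (Set.Ioi 0)) (n : ℕ) :
    Measurable (toyIter J (toyOut L) n) ∧ (∀ x, 0 ≤ toyIter J (toyOut L) n x) ∧
    (∀ x, toyIter J (toyOut L) n x ≤ 1) ∧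
    (∀ x y : ℝ, |x| ≤ |y| → toyIter J (toyOut L) n x ≤ toyIter J (toyOut L) n y) := by
  induction n with
  | zero =>
    refine ⟨?_, ?_, ?_, ?_⟩
    · exact measurable_const.indicator (measurableSet_le measurable_const measurable_norm)
    · exact fun x => Set.indicator_nonneg (fun _ _ => zero_le_one) x
    · exact fun x => Set.indicator_le_self' (fun _ _ => zero_le_one) x
    · intro x y hxy
      simp only [toyIter, toyOut, Set.indicator_apply, Set.mem_ofPred_eq]
      split_ifs <;> linarith
  | succ n ih =>
    obtain ⟨hm, h0, h1, hmono⟩ := ih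
    have hC : ∀ x, |toyIter J (toyOut L) n x| ≤ 1 := fun x => by
      rw [abs_of_nonneg (h0 x)]; exact h1 x
    refine ⟨toy_meas J _ hJ.2.2.1 hm, ?_, ?_, toy_conv_mono J _ hJ hK2 hm 1 hC hmono⟩
    · exact fun x => integral_nonneg (fun y => mul_nonneg (hJ.1 y) (h0 _))
    · intro x
      calc toyIter J (toyOut L) (n+1) x ≤ ∫ y, J y := by
            apply integral_mono (toy_int J _ hJ.2.2.1 hm 1 hC x) hJ.2.2.1
            intro y
            exact mul_le_of_le_one_right (hJ.1 y) (h1 _)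
        _ = 1 := hJ.2.2.2

lemma toy_tail (J : ℝ → ℝ) (L : ℝ) (hJ : K1 J) (n : ℕ) :
    toyIter J (toyOut L) (n + 1) 0 = tailR J n L := by
  have hs : MeasurableSet {x : ℝ | L ≤ |x|} := measurableSet_le measurable_const measurable_norm
  rw [toy_assoc J (toyOut L) hJ.2.2.1 (measurable_const.indicator hs) 1, tailR, ← integral_indicator hs]
  · congr 1; funext y
    simp [toyOut, Set.indicator_apply]
  · intro x
    simp only [toyOut, Set.indicator_apply]
    split_ifs <;> simp

/-- **Proposition (Extinction criterion for the toy problem).** Under (K1) and (K2), if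
`T, L > 0` satisfy `θ e^{-(r⁺+1)T} ∑_{i≥1} (Tⁱ/i!) R_i(L) ≥ ε`, then the solution of
`∂ₜ w = J ∗ w - w + r⁺ (w-θ)₊` starting from `(θ+ε) 1_{(-L,L)}` satisfies
`sup_x w(T,x) ≤ θ`. -/
theorem toy_extinction_criterion
    (J : ℝ → ℝ) (rp θ ε T L : ℝ)
    (hK1 : K1 J) (hK2 : AntitoneOn J (Set.Ioi 0))
    (hrp : 0 < rp) (hθ : θ ∈ Set.Ioo (0:ℝ) 1) (hε : 0 < ε)
    (hT : 0 < T) (hL : 0 < L)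
    (hcrit : ε ≤ θ * Real.exp (-(rp + 1) * T) *
      ∑' n : ℕ, T ^ (n + 1) / (Nat.factorial (n + 1) : ℝ) * tailR J n L)
    (w : ℝ → ℝ → ℝ)
    (hw : IsBddSol J (fun v => rp * max (v - θ) 0) (stepInit (θ + ε) L) w) :
    ∀ x, w T x ≤ θ := by
  obtain ⟨⟨M, hM⟩, hmeas, hcont, hinit, hder⟩ := hw
  obtain ⟨hθ0, hθ1⟩ := hθ
  have hJ := hK1
  obtain ⟨hJ0, hJe, hJi, hJ1⟩ := hK1
  have hop := toy_out_props J L hJ hK2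
  set o := toyIter J (toyOut L) with ho
  have hoabs : ∀ n x, |o n x| ≤ 1 := fun n x => by
    rw [abs_of_nonneg ((hop n).2.1 x)]; exact (hop n).2.2.1 x
  have hM0 : 0 ≤ M := (abs_nonneg _).trans (hM 0 0 le_rfl)
  -- the main comparison
  have main : ∀ N : ℕ, ∀ x, Real.exp T * (w T x - θ - ε * Real.exp (rp * T))
      + θ * ∑ n ∈ Finset.range (N + 1), T ^ n / (Nat.factorial n : ℝ) * o n x ≤ 0 := by
    intro N
    set P : ℝ → ℝ → ℝ := fun t x =>
      ∑ n ∈ Finset.range (N + 1), t ^ n / (Nat.factorial n : ℝ) * o n x with hP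
    set P' : ℝ → ℝ → ℝ := fun t x =>
      ∑ n ∈ Finset.range N, t ^ n / (Nat.factorial n : ℝ) * o (n + 1) x with hP'
    have hPd : ∀ t x, HasDerivAt (fun s => P s x) (P' t x) t := by
      intro t x
      have : (fun s => P s x) = fun s => (∑ n ∈ Finset.range N,
          s ^ (n + 1) / (Nat.factorial (n + 1) : ℝ) * o (n + 1) x) + o 0 x := by
        funext s
        simp only [hP]
        rw [Finset.sum_range_succ']
        simp
      rw [this]
      apply HasDerivAt.add_const
      apply HasDerivAt.fun_sum
      intro n _
      refine (((hasDerivAt_pow (n + 1) t).div_const _).mul_const _).congr_deriv ?_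
      have : (Nat.factorial n : ℝ) ≠ 0 := by positivity
      rw [Nat.factorial_succ]; push_cast; field_simp
    have hP0 : ∀ t x, 0 ≤ t → 0 ≤ P t x := by
      intro t x ht
      exact Finset.sum_nonneg (fun n _ => mul_nonneg (by positivity) ((hop n).2.1 x))
    have hPm : ∀ t, Measurable (P t) := by
      intro t
      exact Finset.measurable_fun_sum _ (fun n _ => ((hop n).1.const_mul _))
    set K : ℝ → ℝ := fun t => ∑ n ∈ Finset.range (N + 1), t ^ n / (Nat.factorial n : ℝ) with hK
    have hPK : ∀ t x, 0 ≤ t → P t x ≤ K t := by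
      intro t x ht
      exact Finset.sum_le_sum (fun n _ =>
        mul_le_of_le_one_right (by positivity) ((hop n).2.2.1 x))
    have hKmono : ∀ t, 0 ≤ t → t ≤ T → K t ≤ K T := by
      intro t ht htT
      apply Finset.sum_le_sum
      intro n _
      gcongr
    have hPconv : ∀ t x, 0 ≤ t → P' t x ≤ ∫ y, J y * P t (x - y) := by
      intro t x ht
      have : (∫ y, J y * P t (x - y)) =
          ∑ n ∈ Finset.range (N + 1), t ^ n / (Nat.factorial n : ℝ) * o (n + 1) x := by
        simp only [hP, Finset.mul_sum]
        rw [integral_finsetSum]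
        · apply Finset.sum_congr rfl
          intro n _
          change _ = _ * ∫ y, J y * o n (x - y)
          rw [← integral_const_mul]
          congr 1; funext y; ring
        · intro n _
          have := (toy_int J (o n) hJi (hop n).1 1 (hoabs n) x).const_mul
            (t ^ n / (Nat.factorial n : ℝ))
          refine this.congr (Eventually.of_forall fun y => ?_)
          simp only; ring
      rw [this, Finset.sum_range_succ]
      have : 0 ≤ t ^ N / (Nat.factorial N : ℝ) * o (N + 1) x :=
        mul_nonneg (by positivity) ((hop (N + 1)).2.1 x)
      linarith
    set E : ℝ → ℝ → ℝ := fun t x =>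
      Real.exp t * (w t x - θ - ε * Real.exp (rp * t)) + θ * P t x with hE
    set W : ℝ → ℝ → ℝ := fun t x =>
      (∫ y, J y * (w t (x - y) - w t x)) + rp * max (w t x - θ) 0 with hW
    set E' : ℝ → ℝ → ℝ := fun t x =>
      (Real.exp t * (w t x - θ - ε * Real.exp (rp * t)) +
        Real.exp t * (W t x - ε * (Real.exp (rp * t) * rp))) + θ * P' t x with hE'
    have hexp : ∀ t : ℝ, HasDerivAt (fun s => Real.exp (rp * s)) (Real.exp (rp * t) * rp) t := by
      intro t
      have h1 : HasDerivAt (fun s : ℝ => rp * s) rp t := by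
        simpa using (hasDerivAt_id t).const_mul rp
      exact h1.exp
    refine toy_comparison E E' T rp (Real.exp T * M + θ * K T) hT hrp ?_ ?_ ?_ ?_ ?_ ?_
    · have := hP0 T 0 hT.le
      have := hPK T 0 hT.le
      have : 0 ≤ K T := by linarith
      positivity
    · intro x
      have hPz : P 0 x = o 0 x := by
        simp only [hP]
        rw [Finset.sum_range_succ']
        simp
      simp only [hE, hinit, hPz]
      simp only [ho, toyIter, toyOut, stepInit, Set.indicator_apply, Set.mem_ofPred_eq, Set.mem_Ioo,
        ← abs_lt, Real.exp_zero, mul_zero]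
      by_cases h : |x| < L
      · simp [h, not_le.2 h]
      · simp [h, not_lt.1 h]; linarith
    · intro x
      have h1 : ContinuousOn (fun t => w t x) (Set.Icc 0 T) :=
        (hcont x).mono Set.Icc_subset_Ici_self
      have h2 : ContinuousOn (fun t => P t x) (Set.Icc 0 T) :=
        fun s _ => (hPd s x).continuousAt.continuousWithinAt
      have h3 : ContinuousOn (fun t => ε * Real.exp (rp * t)) (Set.Icc 0 T) := by fun_prop
      exact (Real.continuous_exp.continuousOn.mul ((h1.sub continuousOn_const).sub h3)).add
        (continuousOn_const.mul h2)
    · intro t x ht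
      exact ((Real.hasDerivAt_exp t).mul (((hder t x ht.1).sub_const θ).sub
        ((hexp t).const_mul ε))).add ((hPd t x).const_mul θ)
    · intro t x ht
      have h1 : w t x ≤ M := (le_abs_self _).trans (hM t x ht.1)
      have h2 : Real.exp t * (w t x - θ - ε * Real.exp (rp * t)) ≤ Real.exp T * M := by
        calc _ ≤ Real.exp t * M := by
              gcongr
              have := mul_pos hε (Real.exp_pos (rp * t))
              linarith
          _ ≤ _ := by
              gcongr
              exact ht.2
      have h3 : θ * P t x ≤ θ * K T := by
        gcongr
        exact (hPK t x ht.1).trans (hKmono t ht.1 ht.2)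
      exact add_le_add h2 h3
    · intro t x b ht hb hEb
      have ht0 := ht.1.le
      have iw : Integrable (fun y => J y * w t (x - y)) :=
        toy_int J _ hJi (hmeas t ht0) M (fun z => hM t z ht0) x
      have iP : Integrable (fun y => J y * P t (x - y)) :=
        toy_int J _ hJi (hPm t) (K t) (fun z => by
          rw [abs_of_nonneg (hP0 t z ht0)]; exact hPK t z ht0) x
      have e1 : (∫ y, J y * (w t (x - y) - w t x)) = (∫ y, J y * w t (x - y)) - w t x := by
        simp only [mul_sub]
        rw [integral_sub iw (hJi.mul_const _), integral_mul_const, hJ1, one_mul]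
      set A : ℝ := θ + ε * Real.exp (rp * t) with hA
      have e2 : (∫ y, J y * E t (x - y)) = Real.exp t * (∫ y, J y * w t (x - y))
          - Real.exp t * A + θ * ∫ y, J y * P t (x - y) := by
        have : (fun y => J y * E t (x - y)) = fun y => (Real.exp t * (J y * w t (x - y))
          - J y * (Real.exp t * A)) + θ * (J y * P t (x - y)) := by
          funext y; simp only [hE, hA]; ring
        have i1 : Integrable (fun y => Real.exp t * (J y * w t (x - y))
          - J y * (Real.exp t * A)) := (iw.const_mul _).sub (hJi.mul_const _)
        rw [this, integral_add i1 (iP.const_mul _),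
          integral_sub (iw.const_mul _) (hJi.mul_const _), integral_mul_const,
          integral_const_mul, integral_const_mul, hJ1, one_mul]
      have iE : Integrable (fun y => J y * E t (x - y)) := by
        have : (fun y => J y * E t (x - y)) = fun y => (Real.exp t * (J y * w t (x - y))
          - J y * (Real.exp t * A)) + θ * (J y * P t (x - y)) := by
          funext y; simp only [hE, hA]; ring
        rw [this]
        exact ((iw.const_mul _).sub (hJi.mul_const _)).add (iP.const_mul _)
      have e3 : (∫ y, J y * E t (x - y)) ≤ b := by
        calc _ ≤ ∫ y, J y * b := by
              apply integral_mono iE (hJi.mul_const b)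
              intro y
              exact mul_le_mul_of_nonneg_left (hEb _) (hJ0 y)
          _ = b := by rw [integral_mul_const, hJ1, one_mul]
      have e4 : Real.exp t * (max (w t x - θ) 0 - ε * Real.exp (rp * t)) ≤ b := by
        rcases le_total (w t x - θ) 0 with h | h
        · rw [max_eq_right h]
          have : 0 < Real.exp t * (ε * Real.exp (rp * t)) := by positivity
          linarith
        · rw [max_eq_left h]
          have h1 := hEb x
          simp only [hE] at h1
          have := mul_nonneg hθ0.le (hP0 t x ht0)
          linarith
      have e5 := mul_le_mul_of_nonneg_left e4 hrp.le
      have e6 := mul_le_mul_of_nonneg_left (hPconv t x ht0) hθ0.le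
      have e7 : E' t x = (Real.exp t * (∫ y, J y * w t (x - y)) - Real.exp t * A + θ * P' t x)
          + rp * (Real.exp t * (max (w t x - θ) 0 - ε * Real.exp (rp * t))) := by
        simp only [hE', hW, e1, hA]; ring
      rw [e7]
      linarith
  intro x
  set a : ℕ → ℝ := fun n => T ^ (n + 1) / (Nat.factorial (n + 1) : ℝ) * tailR J n L with ha
  have hsum : Summable a := by
    by_contra h
    rw [tsum_eq_zero_of_not_summable h, mul_zero] at hcrit
    linarith
  have hfin : ∀ N : ℕ, θ * ∑ n ∈ Finset.range N, a n
      ≤ Real.exp T * (θ + ε * Real.exp (rp * T) - w T x) := by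
    intro N
    have h1 := main N x
    rw [Finset.sum_range_succ'] at h1
    have h2 : ∑ n ∈ Finset.range N, a n ≤ ∑ n ∈ Finset.range N,
        T ^ (n + 1) / (Nat.factorial (n + 1) : ℝ) * o (n + 1) x := by
      apply Finset.sum_le_sum
      intro n _
      simp only [ha]
      rw [← toy_tail J L hJ n]
      gcongr
      exact (hop (n + 1)).2.2.2 0 x (by simp)
    have h3 := mul_le_mul_of_nonneg_left h2 hθ0.le
    have h4 : 0 ≤ θ * (T ^ 0 / (Nat.factorial 0 : ℝ) * o 0 x) :=
      mul_nonneg hθ0.le (mul_nonneg (by positivity) ((hop 0).2.1 x))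
    linarith
  have hlim := le_of_tendsto' (hsum.hasSum.tendsto_sum_nat.const_mul θ) hfin
  have hx : Real.exp (-(rp + 1) * T) * (Real.exp T * Real.exp (rp * T)) = 1 := by
    rw [← Real.exp_add, ← Real.exp_add]
    rw [show -(rp + 1) * T + (T + rp * T) = 0 by ring, Real.exp_zero]
  have hc2 : ε * (Real.exp T * Real.exp (rp * T)) ≤ θ * ∑' n, a n := by
    have := mul_le_mul_of_nonneg_right hcrit
      (by positivity : 0 ≤ Real.exp T * Real.exp (rp * T))
    calc _ ≤ _ := this
      _ = (Real.exp (-(rp + 1) * T) * (Real.exp T * Real.exp (rp * T))) * (θ * ∑' n, a n) := by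
        ring
      _ = _ := by rw [hx, one_mul]
  have : 0 ≤ Real.exp T * (θ - w T x) := by linarith
  have := nonneg_of_mul_nonneg_right this (Real.exp_pos T)
  linarith
end
end

section
/- Let J satisfy (K1), (K2) and the expansion (K3) with 0 < β < 2 and a > 0, and let C > 0 be a constant such that for every i ≥ 1 one has L^β · R_i(L) → i·a·C as L → ∞. Fix r⁺ > 0, θ ∈ (0,1) and a time T > 0. Then for any γ ∈ (0,1) there exists ε₀ > 0 such that for each ε ∈ (0, ε₀) and each L with 0 < L < γ·(θ·a·C·T·e^{−r⁺T})^{1/β}·ε^{−1/β}, the solution w of the semilinear toy problem ∂_t w = J ∗ w − w + r⁺·max(w − θ, 0) with initial datum w(0,x) = (θ+ε)·1_{(−L,L)}(x) satisfies sup_{x∈ℝ} w(T,x) ≤ θ. -/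
open MeasureTheory Filter Set Asymptotics

noncomputable section

lemma aux_half (J : ℝ → ℝ) (hJ0 : ∀ x, 0 ≤ J x) (hJi : Integrable J) (hJ1 : ∫ x, J x = 1)
    (c T : ℝ) (hc : 0 ≤ c) (z : ℝ → ℝ → ℝ)
    (hcont : ∀ x, ContinuousOn (fun t => z t x) (Set.Icc 0 T))
    (hder : ∀ t x, 0 < t → t < T → ∃ d, HasDerivAt (fun s => z s x) d t ∧
      d ≤ (∫ y, J y * max (z t (x - y)) 0) - z t x + c * max (z t x) 0)
    (h0 : ∀ x, z 0 x ≤ 0) (S : ℝ) (hS : 0 ≤ S)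
    (hb : ∀ t x, 0 ≤ t → t ≤ T → z t x ≤ S * Real.exp ((1 + 2 * c) * t)) :
    ∀ t x, 0 ≤ t → t ≤ T → z t x ≤ S / 2 * Real.exp ((1 + 2 * c) * t) := by
  intro t x ht htT
  have key : ∀ s, 0 < s → s < T → ∀ d, HasDerivAt (fun s => z s x) d s →
      d ≤ (∫ y, J y * max (z s (x - y)) 0) - z s x + c * max (z s x) 0 →
      d + z s x ≤ S * (1 + c) * Real.exp ((1 + 2 * c) * s) := by
    intro s hs hsT d _ hd
    have hE := Real.exp_pos ((1 + 2 * c) * s)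
    have hm : ∀ x', max (z s x') 0 ≤ S * Real.exp ((1 + 2 * c) * s) := fun x' =>
      max_le (hb s x' hs.le hsT.le) (by positivity)
    have h1 : (∫ y, J y * max (z s (x - y)) 0)
        ≤ ∫ y, J y * (S * Real.exp ((1 + 2 * c) * s)) := by
      apply integral_mono_of_nonneg
      · exact Eventually.of_forall fun y => mul_nonneg (hJ0 y) (le_max_right _ _)
      · exact hJi.mul_const _
      · exact Eventually.of_forall fun y => mul_le_mul_of_nonneg_left (hm _) (hJ0 y)
    rw [integral_mul_const, hJ1] at h1
    have h2 := mul_le_mul_of_nonneg_left (hm x) hc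
    nlinarith
  have hanti : AntitoneOn (fun s => Real.exp s * z s x - S / 2 * Real.exp ((2 + 2 * c) * s))
      (Set.Icc 0 T) := by
    apply antitoneOn_of_deriv_nonpos (convex_Icc 0 T)
    · apply ContinuousOn.sub
      · exact Real.continuous_exp.continuousOn.mul (hcont x)
      · fun_prop
    · intro s hs
      rw [interior_Icc] at hs
      obtain ⟨d, hd, -⟩ := hder s x hs.1 hs.2
      have : DifferentiableAt ℝ (fun s => z s x) s := hd.differentiableAt
      apply DifferentiableAt.differentiableWithinAt
      fun_prop
    · intro s hs
      rw [interior_Icc] at hs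
      obtain ⟨d, hd, hd2⟩ := hder s x hs.1 hs.2
      have hk := key s hs.1 hs.2 d hd hd2
      have h3 : HasDerivAt (fun s => Real.exp s * z s x - S / 2 * Real.exp ((2 + 2 * c) * s))
          (Real.exp s * z s x + Real.exp s * d
            - S / 2 * (Real.exp ((2 + 2 * c) * s) * ((2 + 2 * c) * 1))) s :=
        ((Real.hasDerivAt_exp s).mul hd).sub
          ((((hasDerivAt_id s).const_mul (2 + 2 * c)).exp).const_mul (S / 2))
      rw [h3.deriv]
      have h4 : Real.exp ((2 + 2 * c) * s) = Real.exp s * Real.exp ((1 + 2 * c) * s) := by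
        rw [← Real.exp_add]; congr 1; ring
      rw [h4]
      have := mul_le_mul_of_nonneg_left hk (Real.exp_pos s).le
      nlinarith
  have h5 := hanti (left_mem_Icc.2 (ht.trans htT)) ⟨ht, htT⟩ ht
  have h4 : Real.exp ((2 + 2 * c) * t) = Real.exp t * Real.exp ((1 + 2 * c) * t) := by
    rw [← Real.exp_add]; congr 1; ring
  simp only [h4, Real.exp_zero, mul_zero] at h5
  have h6 := h0 x
  have h7 : Real.exp t * z t x ≤ Real.exp t * (S / 2 * Real.exp ((1 + 2 * c) * t)) := by
    nlinarith
  exact le_of_mul_le_mul_left h7 (Real.exp_pos t)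

lemma aux_maxp (J : ℝ → ℝ) (hJ0 : ∀ x, 0 ≤ J x) (hJi : Integrable J) (hJ1 : ∫ x, J x = 1)
    (c T : ℝ) (hc : 0 ≤ c) (z : ℝ → ℝ → ℝ)
    (hcont : ∀ x, ContinuousOn (fun t => z t x) (Set.Icc 0 T))
    (hder : ∀ t x, 0 < t → t < T → ∃ d, HasDerivAt (fun s => z s x) d t ∧
      d ≤ (∫ y, J y * max (z t (x - y)) 0) - z t x + c * max (z t x) 0)
    (h0 : ∀ x, z 0 x ≤ 0) (M : ℝ) 
    (hb : ∀ t x, 0 ≤ t → t ≤ T → z t x ≤ M) :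
    ∀ t x, 0 ≤ t → t ≤ T → z t x ≤ 0 := by
  have hn : ∀ n : ℕ, ∀ t x, 0 ≤ t → t ≤ T →
      z t x ≤ (max M 0 / 2 ^ n) * Real.exp ((1 + 2 * c) * t) := by
    intro n
    induction n with
    | zero =>
      intro t x ht htT
      have h1 : (1:ℝ) ≤ Real.exp ((1 + 2 * c) * t) := Real.one_le_exp (by positivity)
      have h2 := hb t x ht htT
      have h3 := le_max_left M 0
      have h4 := le_max_right M 0
      simp only [pow_zero, div_one]
      nlinarith
    | succ n ih =>
      have := aux_half J hJ0 hJi hJ1 c T hc z hcont hder h0 _ (by positivity) ih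
      intro t x ht htT
      convert this t x ht htT using 2
      rw [pow_succ]; field_simp
  intro t x ht htT
  have hl : Tendsto (fun n : ℕ => (max M 0 / 2 ^ n) * Real.exp ((1 + 2 * c) * t)) atTop
      (nhds 0) := by
    have h1 : Tendsto (fun n : ℕ => ((1:ℝ) / 2) ^ n) atTop (nhds 0) :=
      tendsto_pow_atTop_nhds_zero_of_lt_one (by norm_num) (by norm_num)
    have h2 := (h1.const_mul (max M 0)).mul_const (Real.exp ((1 + 2 * c) * t))
    simp only [mul_zero, zero_mul] at h2
    refine h2.congr fun n => ?_
    rw [div_pow, one_pow, mul_one_div]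
  exact ge_of_tendsto' hl fun n => hn n t x ht htT

lemma aux_mass (J : ℝ → ℝ) (hJe : ∀ x, J (-x) = J x)
    (hJi : Integrable J) (hJ1 : ∫ x, J x = 1)
    (hK2 : AntitoneOn J (Set.Ioi 0)) (L : ℝ) (hL : 0 < L) (x : ℝ) :
    tailR J 0 L ≤ ∫ y in {y : ℝ | L ≤ |x - y|}, J y := by
  have habs : ∀ y, J |y| = J y := fun y => by
    rcases abs_choice y with h | h <;> rw [h]
    exact hJe y
  have hA : {y : ℝ | L ≤ |x - y|} = (Metric.ball x L)ᶜ := by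
    ext y; simp [Real.dist_eq, abs_sub_comm]
  have hB : {y : ℝ | L ≤ |y|} = (Metric.ball 0 L)ᶜ := by
    ext y; simp
  have e1 := integral_add_compl (measurableSet_ball (x := x) (ε := L)) hJi
  have e2 := integral_add_compl (measurableSet_ball (x := (0:ℝ)) (ε := L)) hJi
  unfold tailR
  simp only [convIter]
  rw [hA, hB]
  suffices h : ∫ y in Metric.ball x L, J y ≤ ∫ y in Metric.ball 0 L, J y by linarith
  set A := Metric.ball x L with hAdef
  set B := Metric.ball (0:ℝ) L with hBdef
  have mA : MeasurableSet A := measurableSet_ball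
  have mB : MeasurableSet B := measurableSet_ball
  have d1 := integral_inter_add_sdiff (s := A) (t := B) mB hJi.integrableOn
  have d2 := integral_inter_add_sdiff (s := B) (t := A) mA hJi.integrableOn
  rw [Set.inter_comm] at d2
  have fA : volume A ≠ ⊤ := measure_ball_lt_top.ne
  have fB : volume B ≠ ⊤ := measure_ball_lt_top.ne
  have fAB : volume (A \ B) ≠ ⊤ := measure_ne_top_of_subset sdiff_subset fA
  have fBA : volume (B \ A) ≠ ⊤ := measure_ne_top_of_subset sdiff_subset fB
  have v : volume.real (A \ B) = volume.real (B \ A) := by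
    have v1 := measureReal_inter_add_sdiff (μ := volume) (s := A) (t := B) mB (h := fA)
    have v2 := measureReal_inter_add_sdiff (μ := volume) (s := B) (t := A) mA (h := fB)
    rw [Set.inter_comm] at v2
    have v3 : volume.real A = volume.real B := by simp [A, B, Measure.real]
    linarith
  have hne : ∀ᵐ y : ℝ, y ≠ 0 := by simp [ae_iff]
  have i1 : ∫ y in A \ B, J y ≤ ∫ y in A \ B, J L := by
    apply setIntegral_mono_on hJi.integrableOn (integrableOn_const fAB) (mA.diff mB)
    intro y hy
    have : L ≤ |y| := by simpa [B] using hy.2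
    rw [← habs y]
    exact hK2 hL (lt_of_lt_of_le hL this) this
  have i2 : ∫ y in B \ A, J L ≤ ∫ y in B \ A, J y := by
    apply setIntegral_mono_on_ae (integrableOn_const fBA) hJi.integrableOn (mB.diff mA)
    filter_upwards [hne] with y hy0 hy
    have : |y| < L := by simpa [B] using hy.1
    rw [← habs y]
    exact hK2 (abs_pos.2 hy0) hL this.le
  rw [setIntegral_const, smul_eq_mul] at i1 i2
  rw [v] at i1
  linarith

/-- modulus -/
def kap (J : ℝ → ℝ) (d : ℝ) : ℝ := ∫ y, J y * min 1 (|y| / d)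

lemma kap_int (J : ℝ → ℝ) (hJi : Integrable J) (d : ℝ) (hd : 0 < d) :
    Integrable (fun y => J y * min 1 (|y| / d)) := by
  apply hJi.mul_bdd (c := 1)
  · exact (by fun_prop : Continuous fun y : ℝ => min (1:ℝ) (|y| / d)).aestronglyMeasurable
  · refine Eventually.of_forall fun y => ?_
    rw [Real.norm_eq_abs, abs_of_nonneg (le_min zero_le_one (by positivity))]
    exact min_le_left _ _

lemma kap_tendsto (J : ℝ → ℝ) (hJi : Integrable J) :
    Tendsto (kap J) atTop (nhds 0) := by
  have h0 : (0:ℝ) = ∫ y : ℝ, (0:ℝ) := by simp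
  unfold kap
  rw [h0]
  apply tendsto_integral_filter_of_dominated_convergence (fun y => |J y|)
  · filter_upwards [eventually_gt_atTop 0] with d hd
    exact (kap_int J hJi d hd).aestronglyMeasurable
  · filter_upwards [eventually_gt_atTop 0] with d hd
    refine Eventually.of_forall fun y => ?_
    have hmin : 0 ≤ min 1 (|y| / d) := le_min zero_le_one (by positivity)
    rw [norm_mul, Real.norm_eq_abs, Real.norm_eq_abs, abs_of_nonneg hmin]
    exact mul_le_of_le_one_right (abs_nonneg _) (min_le_left _ _)
  · exact hJi.abs
  · refine Eventually.of_forall fun y => ?_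
    have h1 : Tendsto (fun d : ℝ => |y| / d) atTop (nhds 0) := tendsto_const_nhds.div_atTop tendsto_id
    have h2 := ((tendsto_const_nhds (x := (1:ℝ))).min h1).const_mul (J y)
    simpa using h2

/-- cutoff -/
def cutf (L₀ L₁ x : ℝ) : ℝ := max 0 (min 1 ((L₁ - |x|) / (L₁ - L₀)))

lemma cutf_diff (L₀ L₁ x y : ℝ) (h : L₀ < L₁) :
    cutf L₀ L₁ (x - y) - cutf L₀ L₁ x ≤ min 1 (|y| / (L₁ - L₀)) := by
  have hd : 0 < L₁ - L₀ := by linarith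
  have h1 : (L₁ - |x - y|) / (L₁ - L₀) ≤ (L₁ - |x|) / (L₁ - L₀) + |y| / (L₁ - L₀) := by
    rw [← add_div]
    apply div_le_div_of_nonneg_right _ hd.le
    have := abs_sub_abs_le_abs_sub x y
    linarith
  have h2 : 0 ≤ |y| / (L₁ - L₀) := by positivity
  unfold cutf
  apply le_min
  · have : max 0 (min 1 ((L₁ - |x - y|) / (L₁ - L₀))) ≤ 1 :=
      max_le zero_le_one (min_le_left _ _)
    have := le_max_left 0 (min 1 ((L₁ - |x|) / (L₁ - L₀)))
    linarith
  · generalize (L₁ - |x - y|) / (L₁ - L₀) = A at *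
    generalize (L₁ - |x|) / (L₁ - L₀) = B at *
    generalize |y| / (L₁ - L₀) = D at *
    simp only [max_def, min_def]
    split_ifs <;> linarith

lemma int_bdd (J : ℝ → ℝ) (hJi : Integrable J) (g : ℝ → ℝ) (hg : Measurable g) (M : ℝ)
    (hM : ∀ x, |g x| ≤ M) : Integrable (fun y => J y * g y) :=
  hJi.mul_bdd hg.aestronglyMeasurable (Eventually.of_forall hM)

lemma aux_core (J : ℝ → ℝ) (rp θ T ε L₀ L₁ L : ℝ)
    (hJ0 : ∀ x, 0 ≤ J x) (hJe : ∀ x, J (-x) = J x)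
    (hJi : Integrable J) (hJ1 : ∫ x, J x = 1)
    (hK2 : AntitoneOn J (Set.Ioi 0)) (hrp : 0 < rp) (hθ : 0 < θ) (hT : 0 < T)
    (hε : 0 < ε) (hL0 : 0 < L) (hLL : L ≤ L₀) (hL01 : L₀ < L₁) (η : ℝ)
    (hη : η = (ε + (θ + ε) * kap J (L₁ - L₀) / rp) * Real.exp (rp * T))
    (hηθ : η ≤ θ)
    (hmain : ε ≤ (θ - η) * tailR J 0 L₁ * T * Real.exp (-(rp * T)))
    (w : ℝ → ℝ → ℝ)
    (hw : IsBddSol J (fun v => rp * max (v - θ) 0) (stepInit (θ + ε) L) w) :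
    ∀ x, w T x ≤ θ := by
  obtain ⟨⟨M, hM⟩, hmeas, hwc, hw0, hwd⟩ := hw
  have hd : 0 < L₁ - L₀ := by linarith
  set κ := kap J (L₁ - L₀) with hκ
  have hκ0 : 0 ≤ κ := integral_nonneg fun y => mul_nonneg (hJ0 y) (le_min zero_le_one (by positivity))
  set Q := ε + (θ + ε) * κ / rp with hQ
  have hQ0 : 0 < Q := by positivity
  have hQr : rp * Q = rp * ε + (θ + ε) * κ := by rw [hQ]; field_simp
  have hφ0 : ∀ x, 0 ≤ cutf L₀ L₁ x := fun x => le_max_left _ _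
  have hφ1 : ∀ x, cutf L₀ L₁ x ≤ 1 := fun x => max_le zero_le_one (min_le_left _ _)
  have hmx : ∀ t x, 0 ≤ t → Measurable fun y => w t (x - y) := fun t x ht =>
    (hmeas t ht).comp (measurable_const.sub measurable_id)
  have intw : ∀ t x, 0 ≤ t → Integrable fun y => J y * (w t (x - y) - w t x) := fun t x ht =>
    int_bdd J hJi _ ((hmx t x ht).sub_const _) (M + M) fun y =>
      (abs_sub _ _).trans (add_le_add (hM _ _ ht) (hM _ _ ht))
  have hM0 : 0 ≤ M := (abs_nonneg _).trans (hM 0 0 le_rfl)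
  have hcut : Measurable (cutf L₀ L₁) :=
    (by unfold cutf; fun_prop : Continuous (cutf L₀ L₁)).measurable
  -- Step 1
  have step1 : ∀ t x, 0 ≤ t → t ≤ T →
      w t x - (θ + ε) * cutf L₀ L₁ x - Q * (Real.exp (rp * t) - 1) ≤ 0 := by
    apply aux_maxp J hJ0 hJi hJ1 rp T hrp.le
      (fun t x => w t x - (θ + ε) * cutf L₀ L₁ x - Q * (Real.exp (rp * t) - 1)) _ _ _ M
    · intro t x ht htT
      have h1 := (abs_le.1 (hM t x ht)).2
      have h2 : (1:ℝ) ≤ Real.exp (rp * t) := Real.one_le_exp (by positivity)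
      have h3 := hφ0 x
      have : 0 ≤ (θ + ε) * cutf L₀ L₁ x := by positivity
      nlinarith
    · intro x
      have := (hwc x).mono (fun s (hs : s ∈ Set.Icc 0 T) => hs.1)
      fun_prop
    · intro t x ht htT
      refine ⟨_, ((hwd t x ht).sub_const _).sub
        (((((hasDerivAt_id t).const_mul rp).exp).sub_const 1).const_mul Q), ?_⟩
      simp only [id, mul_one]
      have hE : (1:ℝ) ≤ Real.exp (rp * t) := Real.one_le_exp (by positivity)
      set E := Real.exp (rp * t)
      set z : ℝ → ℝ := fun x => w t x - (θ + ε) * cutf L₀ L₁ x - Q * (E - 1) with hz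
      have mz : Measurable z := (((hmeas t ht.le).sub (hcut.const_mul _)).sub_const _)
      have bz : ∀ x, |max (z x) 0| ≤ M := fun x => by
        rw [abs_of_nonneg (le_max_right _ _)]
        refine max_le ?_ hM0
        have h1 := (abs_le.1 (hM t x ht.le)).2
        have h3 := hφ0 x
        have : 0 ≤ (θ + ε) * cutf L₀ L₁ x := by positivity
        simp only [hz]
        nlinarith
      have i1 : Integrable fun y => J y * max (z (x - y)) 0 :=
        int_bdd J hJi _ ((mz.comp (measurable_const.sub measurable_id)).max measurable_const) M
          fun y => bz _
      have i2 := kap_int J hJi _ hd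
      have i3 : Integrable fun y => J y * max (z (x - y)) 0 - J y * z x :=
        i1.sub (hJi.mul_const _)
      have hI : (∫ y, J y * (w t (x - y) - w t x)) ≤
          ∫ y, (J y * max (z (x - y)) 0 - J y * z x
            + (J y * min 1 (|y| / (L₁ - L₀))) * (θ + ε)) := by
        apply integral_mono (intw t x ht.le) (i3.add (i2.mul_const (θ + ε)))
        intro y
        have h1 := cutf_diff L₀ L₁ x y hL01
        have h2 := le_max_left (z (x - y)) 0
        have h3 : w t (x - y) - w t x ≤ max (z (x - y)) 0 - z x
            + min 1 (|y| / (L₁ - L₀)) * (θ + ε) := by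
          have h4 := mul_le_mul_of_nonneg_left h1 (by positivity : 0 ≤ θ + ε)
          have h5 : z (x - y) = w t (x - y) - (θ + ε) * cutf L₀ L₁ (x - y) - Q * (E - 1) := rfl
          have h6 : z x = w t x - (θ + ε) * cutf L₀ L₁ x - Q * (E - 1) := rfl
          linarith
        have := mul_le_mul_of_nonneg_left h3 (hJ0 y)
        simp only [Pi.add_apply]
        linarith
      rw [integral_add i3 (i2.mul_const _),
        integral_sub i1 (hJi.mul_const _), integral_mul_const, integral_mul_const, hJ1] at hI
      change _ ≤ _ - _ + κ * _ at hI
      have hr : max (w t x - θ) 0 ≤ max (z x) 0 + ε + Q * (E - 1) := by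
        have h7 : 0 ≤ Q * (E - 1) := mul_nonneg hQ0.le (by linarith)
        have h8 := le_max_left (z x) 0
        have h9 := le_max_right (z x) 0
        have h6 : z x = w t x - (θ + ε) * cutf L₀ L₁ x - Q * (E - 1) := rfl
        have h10 := mul_le_mul_of_nonneg_left (hφ1 x) (by positivity : 0 ≤ θ + ε)
        apply max_le <;> linarith
      have hr2 := mul_le_mul_of_nonneg_left hr hrp.le
      change _ ≤ _ - z x + rp * max (z x) 0
      nlinarith
    · intro x
      simp only [mul_zero, Real.exp_zero, sub_self, sub_zero, hw0]
      unfold stepInit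
      by_cases hx : x ∈ Set.Ioo (-L) L
      · rw [Set.indicator_of_mem hx]
        have hx' : |x| < L := abs_lt.2 hx
        have : cutf L₀ L₁ x = 1 := by
          unfold cutf
          rw [min_eq_left, max_eq_right zero_le_one]
          rw [le_div_iff₀ hd]; linarith
        rw [this]; linarith
      · rw [Set.indicator_of_notMem hx]
        have h3 := hφ0 x
        have : 0 ≤ (θ + ε) * cutf L₀ L₁ x := by positivity
        linarith
  have far : ∀ t x, 0 ≤ t → t ≤ T → L₁ ≤ |x| → w t x ≤ η := by
    intro t x ht htT hx
    have h1 := step1 t x ht htT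
    have h2 : cutf L₀ L₁ x = 0 := by
      unfold cutf
      apply max_eq_left
      exact (min_le_right _ _).trans (div_nonpos_of_nonpos_of_nonneg (by linarith) hd.le)
    rw [h2] at h1
    have h3 : Real.exp (rp * t) ≤ Real.exp (rp * T) :=
      Real.exp_le_exp.2 (mul_le_mul_of_nonneg_left htT hrp.le)
    rw [hη]
    nlinarith
  -- Step 2
  have htail0 : 0 ≤ tailR J 0 L₁ := integral_nonneg fun y => hJ0 y
  set b := (θ - η) * tailR J 0 L₁ with hb
  have hb0 : 0 ≤ b := mul_nonneg (by linarith) htail0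
  have hp0 : ∀ t, t ≤ T → 0 ≤ b / rp * (1 - Real.exp (rp * (t - T))) := by
    intro t ht
    have : Real.exp (rp * (t - T)) ≤ 1 := Real.exp_le_one_iff.2
      (mul_nonpos_of_nonneg_of_nonpos hrp.le (by linarith))
    have h2 : 0 ≤ 1 - Real.exp (rp * (t - T)) := by linarith
    positivity
  have step2 : ∀ t x, 0 ≤ t → t ≤ T →
      w t x - θ - b / rp * (1 - Real.exp (rp * (t - T))) ≤ 0 := by
    apply aux_maxp J hJ0 hJi hJ1 rp T hrp.le
      (fun t x => w t x - θ - b / rp * (1 - Real.exp (rp * (t - T)))) _ _ _ M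
    · intro t x ht htT
      have h1 := (abs_le.1 (hM t x ht)).2
      have h2 := hp0 t htT
      linarith
    · intro x
      have := (hwc x).mono (fun s (hs : s ∈ Set.Icc 0 T) => hs.1)
      fun_prop
    · intro t x ht htT
      refine ⟨_, ((hwd t x ht).sub_const _).sub
        (((((hasDerivAt_id t).sub_const T).const_mul rp).exp.const_sub 1).const_mul (b / rp)), ?_⟩
      simp only [id, mul_one]
      have hp := hp0 t htT.le
      set E := Real.exp (rp * (t - T))
      set p := b / rp * (1 - E) with hpdef
      set z : ℝ → ℝ := fun x => w t x - θ - p with hz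
      have hzx : ∀ x, z x = w t x - θ - p := fun _ => rfl
      have mz : Measurable z := (((hmeas t ht.le).sub_const _).sub_const _)
      have bz : ∀ x, |max (z x) 0| ≤ M := fun x => by
        rw [abs_of_nonneg (le_max_right _ _)]
        refine max_le ?_ hM0
        have h1 := (abs_le.1 (hM t x ht.le)).2
        rw [hzx]
        linarith
      have i1 : Integrable fun y => J y * max (z (x - y)) 0 :=
        int_bdd J hJi _ ((mz.comp (measurable_const.sub measurable_id)).max measurable_const) M
          fun y => bz _
      have mS : MeasurableSet {y : ℝ | L₁ ≤ |x - y|} :=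
        measurableSet_le measurable_const (by fun_prop)
      have i2 : Integrable (Set.indicator {y : ℝ | L₁ ≤ |x - y|} J) := hJi.indicator mS
      have i3 : Integrable fun y => J y * max (z (x - y)) 0 - J y * z x :=
        i1.sub (hJi.mul_const _)
      have hI : (∫ y, J y * (w t (x - y) - w t x)) ≤
          ∫ y, (J y * max (z (x - y)) 0 - J y * z x
            - (Set.indicator {y : ℝ | L₁ ≤ |x - y|} J y) * (θ - η)) := by
        apply integral_mono (intw t x ht.le) (i3.sub (i2.mul_const (θ - η)))
        intro y
        simp only [Pi.sub_apply]
        by_cases hy : L₁ ≤ |x - y|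
        · rw [Set.indicator_of_mem (by exact hy)]
          have h1 := far t (x - y) ht.le htT.le hy
          have h2 := le_max_right (z (x - y)) 0
          have h3 : w t (x - y) - w t x ≤ max (z (x - y)) 0 - z x - (θ - η) := by
            rw [hzx x]; linarith
          have := mul_le_mul_of_nonneg_left h3 (hJ0 y)
          linarith
        · rw [Set.indicator_of_notMem (by exact hy)]
          have h2 := le_max_left (z (x - y)) 0
          have h3 : w t (x - y) - w t x ≤ max (z (x - y)) 0 - z x := by
            rw [hzx x]; rw [hzx (x - y)] at h2 ⊢; linarith
          have := mul_le_mul_of_nonneg_left h3 (hJ0 y)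
          linarith
      rw [integral_sub i3 (i2.mul_const _),
        integral_sub i1 (hJi.mul_const _), integral_mul_const, integral_mul_const, hJ1,
        integral_indicator mS] at hI
      have hmass := aux_mass J hJe hJi hJ1 hK2 L₁ (by linarith) x
      have hm2 := mul_le_mul_of_nonneg_right hmass (by linarith : 0 ≤ θ - η)
      have hr : max (w t x - θ) 0 ≤ max (z x) 0 + p := by
        have h8 := le_max_left (z x) 0
        have h9 := le_max_right (z x) 0
        have h6 := hzx x
        apply max_le <;> linarith
      have hr2 := mul_le_mul_of_nonneg_left hr hrp.le
      have hrpp : rp * p = b - b * E := by rw [hpdef]; field_simp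
      have hdp : b / rp * -(E * rp) = - (b * E) := by field_simp
      change _ ≤ _ - z x + rp * max (z x) 0
      rw [hdp]
      nlinarith
    · intro x
      simp only [zero_sub, hw0]
      have h1 : stepInit (θ + ε) L x ≤ θ + ε := by
        unfold stepInit
        exact Set.indicator_apply_le' (fun _ => le_rfl) (fun _ => by positivity)
      have h2 : T * rp * Real.exp (-(rp * T)) ≤ 1 - Real.exp (rp * -T) := by
        rw [mul_neg]
        have h3 := Real.add_one_le_exp (rp * T)
        have h4 : Real.exp (-(rp * T)) * Real.exp (rp * T) = 1 := by
          rw [← Real.exp_add]; simp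
        have h5 := Real.exp_pos (-(rp * T))
        nlinarith
      have h3 := mul_le_mul_of_nonneg_left h2 (by positivity : 0 ≤ b / rp)
      have h4 : b / rp * (T * rp * Real.exp (-(rp * T))) = b * T * Real.exp (-(rp * T)) := by
        field_simp
      linarith
  intro x
  have := step2 T x hT.le le_rfl
  simp only [sub_self, mul_zero, Real.exp_zero, sub_zero] at this
  linarith


/-- **Corollary (Asymptotic extinction criterion for the toy problem, 0 < β < 2).**
Under (K1), (K2), (K3) with `0 < β < 2`, `a > 0`, if `C > 0` satisfies
`L^β R_i(L) → i a C` for every `i ≥ 1`, then for any `γ ∈ (0,1)` there is `ε₀ > 0` such that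
for each `ε ∈ (0, ε₀)` and each `0 < L < γ (θ a C T e^{-r⁺T})^{1/β} ε^{-1/β}`, the solution of
`∂ₜ w = J ∗ w - w + r⁺ (w-θ)₊` starting from `(θ+ε) 1_{(-L,L)}` is everywhere `≤ θ` at
time `T`. -/
theorem toy_asymptotic_extinction_beta_lt_two
    (J : ℝ → ℝ) (rp θ T a β C : ℝ)
    (hK1 : K1 J) (hK2 : AntitoneOn J (Set.Ioi 0))
    (hβ : 0 < β) (hβ2 : β < 2) (ha : 0 < a) (hK3 : K3 J a β)
    (hC : 0 < C)
    (htail : ∀ n : ℕ, Tendsto (fun L : ℝ => L ^ β * tailR J n L)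
      atTop (nhds (((n : ℝ) + 1) * a * C)))
    (hrp : 0 < rp) (hθ : θ ∈ Set.Ioo (0:ℝ) 1) (hT : 0 < T) :
    ∀ γ, 0 < γ → γ < 1 →
      ∃ ε₀ > 0, ∀ ε, 0 < ε → ε < ε₀ → ∀ L, 0 < L →
        L < γ * (θ * a * C * T * Real.exp (-(rp * T))) ^ (1/β) / ε ^ (1/β) →
        ∀ w, IsBddSol J (fun v => rp * max (v - θ) 0) (stepInit (θ + ε) L) w →
          ∀ x, w T x ≤ θ := by
  intro γ hγ hγ1
  obtain ⟨hJ0, hJe, hJi, hJ1⟩ := hK1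
  obtain ⟨hθ0, -⟩ := hθ
  set K := θ * a * C * T * Real.exp (-(rp * T)) with hK
  have hK0 : 0 < K := by positivity
  obtain ⟨γ', hg1, hg2⟩ := exists_between hγ1
  have hg0 : 0 < γ' := hγ.trans hg1
  have hβi : 0 < 1 / β := by positivity
  have hD : Tendsto (fun ε : ℝ => (K / ε) ^ (1 / β)) (nhdsWithin 0 (Set.Ioi 0)) atTop := by
    refine (tendsto_rpow_atTop hβi).comp ?_
    refine (tendsto_inv_nhdsGT_zero.const_mul_atTop hK0).congr fun ε => ?_
    rw [div_eq_mul_inv]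
  have hid : Tendsto (fun ε : ℝ => ε) (nhdsWithin 0 (Set.Ioi 0)) (nhds 0) :=
    tendsto_id.mono_left nhdsWithin_le_nhds
  have hκ : Tendsto (fun ε : ℝ => kap J (γ' * (K / ε) ^ (1 / β) - γ * (K / ε) ^ (1 / β)))
      (nhdsWithin 0 (Set.Ioi 0)) (nhds 0) := by
    refine (kap_tendsto J hJi).comp ?_
    refine (hD.const_mul_atTop (sub_pos.2 hg1)).congr fun ε => ?_
    ring
  have hη : Tendsto (fun ε : ℝ => (ε + (θ + ε) *
      kap J (γ' * (K / ε) ^ (1 / β) - γ * (K / ε) ^ (1 / β)) / rp) * Real.exp (rp * T))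
      (nhdsWithin 0 (Set.Ioi 0)) (nhds 0) := by
    have := (hid.add (((hid.const_add θ).mul hκ).div_const rp)).mul_const (Real.exp (rp * T))
    simpa using this
  have ht := (htail 0).comp (hD.const_mul_atTop hg0)
  have hlim := (hη.const_sub θ).mul ht
  simp only [Nat.cast_zero, zero_add, one_mul, sub_zero] at hlim
  have hgβ : γ' ^ β < 1 := Real.rpow_lt_one hg0.le hg2 hβ
  have hlt : γ' ^ β * (θ * (a * C)) < θ * (a * C) := mul_lt_of_lt_one_left (by positivity) hgβ
  have hev := (hlim.eventually_const_lt hlt).and (hη.eventually_lt_const hθ0)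
  rw [eventually_nhdsWithin_iff] at hev
  obtain ⟨e0, he0, hball⟩ := Metric.eventually_nhds_iff.1 hev
  refine ⟨e0, he0, fun ε hε hεe L hL hLb w hw => ?_⟩
  obtain ⟨hm, hηθ⟩ := hball (y := ε) (by simpa [abs_of_pos hε] using hεe) hε
  simp only [Function.comp] at hm
  have hLb' : L ≤ γ * (K / ε) ^ (1 / β) := by
    rw [Real.div_rpow hK0.le hε.le, ← mul_div_assoc]; exact hLb.le
  have hDpos : 0 < (K / ε) ^ (1 / β) := by positivity
  refine aux_core J rp θ T ε _ (γ' * (K / ε) ^ (1 / β)) L hJ0 hJe hJi hJ1 hK2 hrp hθ0 hT hε hL hLb'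
    (mul_lt_mul_of_pos_right hg1 hDpos) _ rfl hηθ.le ?_ w hw
  have hpow : (γ' * (K / ε) ^ (1 / β)) ^ β = γ' ^ β * (K / ε) := by
    rw [Real.mul_rpow hg0.le hDpos.le, ← Real.rpow_mul (by positivity), one_div_mul_cancel hβ.ne',
      Real.rpow_one]
  rw [hpow] at hm
  generalize (ε + (θ + ε) * kap J (γ' * (K / ε) ^ (1 / β) - γ * (K / ε) ^ (1 / β)) / rp) *
    Real.exp (rp * T) = η at *
  generalize tailR J 0 (γ' * (K / ε) ^ (1 / β)) = R at *
  have hgp : 0 < γ' ^ β := by positivity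
  have h1 : θ * (a * C) < (θ - η) * (K / ε * R) := by
    have : γ' ^ β * (θ * (a * C)) < γ' ^ β * ((θ - η) * (K / ε * R)) := by linarith
    exact lt_of_mul_lt_mul_left this hgp.le
  have hE := Real.exp_pos (-(rp * T))
  have h2 : K / ε * ε = K := by field_simp
  have h3 : θ * (a * C) * ε < (θ - η) * R * K := by
    calc θ * (a * C) * ε < (θ - η) * (K / ε * R) * ε := mul_lt_mul_of_pos_right h1 hε
      _ = (θ - η) * R * (K / ε * ε) := by ring
      _ = _ := by rw [h2]
  have h4 : θ * (a * C) * ε < θ * (a * C) * ((θ - η) * R * T * Real.exp (-(rp * T))) := by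
    rw [hK] at h3; linarith
  exact (lt_of_mul_lt_mul_left h4 (by positivity)).le
end
end

section
/- Let J ∈ C¹(ℝ) be nonnegative, even, with ∫_ℝ J(x) dx = 1, J' ∈ L¹(ℝ), and finite first moment ∫_ℝ |y| J(y) dy < ∞. Let f ∈ C¹(ℝ) satisfy f(0) = f(1) = 0, f'(0) < 0 and f'(1) < 0. Let c ∈ ℝ and let U : ℝ → ℝ be a nondecreasing differentiable function with 0 ≤ U ≤ 1, U(x) → 0 as x → −∞, U(x) → 1 as x → +∞, satisfying (J ∗ U)(x) − U(x) − c·U'(x) + f(U(x)) = 0 for all x ∈ ℝ. Then ∫_{−∞}^0 U(x) dx < ∞ and ∫_0^{+∞} (1 − U(x)) dx < ∞. -/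
open MeasureTheory Filter Set Asymptotics

noncomputable section

theorem wave_left
    (J f U : ℝ → ℝ) (c : ℝ)
    (hJc : Continuous J) (hJpos : ∀ x, 0 ≤ J x)
    (hJint : Integrable J) (hJmass : (∫ x, J x) = 1)
    (hJmom : Integrable (fun y => |y| * J y))
    (hfd : DifferentiableAt ℝ f 0)
    (hf0 : f 0 = 0) 
    (hf'0 : deriv f 0 < 0)
    (hUmono : Monotone U) (hUdiff : Differentiable ℝ U)
    (hU01 : ∀ x, U x ∈ Set.Icc (0:ℝ) 1)
    (hUbot : Tendsto U atBot (nhds 0))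
    (hTW : ∀ x, (∫ y, J y * U (x - y)) - U x - c * deriv U x + f (U x) = 0) :
    IntegrableOn U (Set.Iic 0) := by
  have hUc : Continuous U := hUdiff.continuous
  obtain ⟨a, ha, hab⟩ : ∃ a > 0, ∀ᶠ x in atBot, f (U x) ≤ - a * U x := by
    refine ⟨-(deriv f 0) / 2, by linarith, ?_⟩
    have h1 := hfd.hasDerivAt.isLittleO.def (c := -(deriv f 0) / 2) (by linarith)
    filter_upwards [hUbot.eventually h1] with x hx
    have h0 := (hU01 x).1
    simp only [hf0, sub_zero, smul_eq_mul, Real.norm_eq_abs, abs_of_nonneg h0] at hx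
    have := (abs_le.1 hx).2
    nlinarith
  obtain ⟨x0, hx0⟩ := eventually_atBot.1 hab
  have hIJ : ∀ x, Integrable (fun y => J y * U (x - y)) := fun x => by
    refine hJint.mono (by fun_prop) (ae_of_all _ fun y => ?_)
    rw [norm_mul]
    refine mul_le_of_le_one_right (norm_nonneg _) ?_
    rw [Real.norm_eq_abs, abs_of_nonneg (hU01 _).1]; exact (hU01 _).2
  have hG : ∀ x, (∫ y, J y * U (x - y)) - U x = ∫ y, J y * (U (x - y) - U x) := fun x => by
    simp only [mul_sub]
    rw [integral_sub (hIJ x) (hJint.mul_const _), integral_mul_const, hJmass, one_mul]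
  have hprod : ∀ r, Integrable (Function.uncurry fun x y => J y * (U (x - y) - U x))
      ((volume.restrict (Set.Ioc r x0)).prod volume) := fun r => by
    have hb : Integrable (fun p : ℝ × ℝ => (1:ℝ) * J p.2)
      ((volume.restrict (Set.Ioc r x0)).prod volume) :=
      Integrable.mul_prod (integrable_const (1:ℝ)) hJint
    refine hb.mono (Continuous.aestronglyMeasurable (by unfold Function.uncurry; fun_prop))
      (ae_of_all _ fun p => ?_)
    simp only [Function.uncurry, one_mul, norm_mul]
    refine mul_le_of_le_one_right (norm_nonneg _) ?_
    rw [Real.norm_eq_abs, abs_le]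
    have h1 := hU01 (p.1 - p.2)
    have h2 := hU01 p.1
    constructor <;> linarith [h1.1, h1.2, h2.1, h2.2]
  have hUi : ∀ p q, IntervalIntegrable U volume p q := fun p q => hUc.intervalIntegrable _ _
  have hle : ∀ p q, |∫ x in p..q, U x| ≤ |q - p| := fun p q => by
    have := intervalIntegral.norm_integral_le_of_norm_le_const (a := p) (b := q) (f := U) (C := 1)
      (fun x _ => by rw [Real.norm_eq_abs, abs_of_nonneg (hU01 _).1]; exact (hU01 _).2)
    simpa using this
  have hK : ∀ r y, |∫ x in r..x0, (U (x - y) - U x)| ≤ 2 * |y| := fun r y => by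
    rw [intervalIntegral.integral_sub ((by fun_prop : Continuous fun x => U (x - y)).intervalIntegrable _ _) (hUi _ _),
      intervalIntegral.integral_comp_sub_right,
      intervalIntegral.integral_interval_sub_interval_comm (hUi _ _) (hUi _ _) (hUi _ _)]
    refine (abs_sub _ _).trans ?_
    have h1 := hle (r - y) r
    have h2 := hle (x0 - y) x0
    rw [sub_sub_cancel] at h1 h2
    linarith
  set M := ∫ y, |y| * J y
  have hbound : ∀ r ≤ x0, ∫ x in r..x0, U x ≤ (2 * M + |c|) / a := fun r hr => by
    have hGi : IntervalIntegrable (fun x => ∫ y, J y * (U (x - y) - U x)) volume r x0 :=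
      (intervalIntegrable_iff_integrableOn_Ioc_of_le hr).2 (hprod r).integral_prod_left
    have hUd : IntervalIntegrable (deriv U) volume r x0 :=
      (intervalIntegrable_iff_integrableOn_Ioc_of_le hr).2 
        (intervalIntegral.integrableOn_deriv_of_nonneg hUc.continuousOn
          (fun x _ => (hUdiff x).hasDerivAt) (fun x _ => hUmono.deriv_nonneg))
    have h1 : ∫ x in r..x0, a * U x ≤
        ∫ x in r..x0, ((∫ y, J y * (U (x - y) - U x)) - c * deriv U x) := by
      refine intervalIntegral.integral_mono_on hr ((hUi _ _).const_mul _)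
        (hGi.sub (hUd.const_mul _)) fun x hx => ?_
      rw [← hG]
      linarith [hTW x, hx0 x hx.2]
    rw [intervalIntegral.integral_sub hGi (hUd.const_mul _), intervalIntegral.integral_const_mul,
      intervalIntegral.integral_const_mul,
      intervalIntegral.integral_deriv_eq_sub (fun x _ => hUdiff x) hUd] at h1
    have h2 : ∫ x in r..x0, (∫ y, J y * (U (x - y) - U x)) ≤ 2 * M := by
      rw [intervalIntegral.integral_of_le hr, integral_integral_swap (hprod r), 
        ← integral_const_mul]
      have := (hprod r).integral_prod_right
      refine integral_mono this (hJmom.const_mul 2) fun y => ?_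
      simp only
      rw [integral_const_mul, ← intervalIntegral.integral_of_le hr]
      have := mul_le_mul_of_nonneg_left ((le_abs_self _).trans (hK r y)) (hJpos y)
      linarith
    have h3 : - (c * (U x0 - U r)) ≤ |c| := by
      have h4 : |c * (U x0 - U r)| ≤ |c| := by
        rw [abs_mul]
        refine mul_le_of_le_one_right (abs_nonneg _) ?_
        rw [abs_le]
        constructor <;> linarith [(hU01 x0).1, (hU01 x0).2, (hU01 r).1, (hU01 r).2]
      exact (neg_le_abs _).trans h4
    rw [le_div_iff₀ ha]
    linarith
  have hI : IntegrableOn U (Set.Iic x0) := by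
    refine integrableOn_Iic_of_intervalIntegral_norm_bounded (l := atBot) (a := id) ((2 * M + |c|) / a) x0
      (fun r => (hUc.integrableOn_Icc).mono_set Set.Ioc_subset_Icc_self) tendsto_id ?_
    filter_upwards [eventually_le_atBot x0] with r hr
    simp only [id, Real.norm_eq_abs, abs_of_nonneg (hU01 _).1]
    exact hbound r hr
  refine (hI.union (hUc.integrableOn_Icc (a := x0) (b := 0))).mono_set fun x hx => ?_
  rcases le_total x x0 with h | h
  · exact Or.inl h
  · exact Or.inr ⟨h, hx⟩

/-- **Lemma (Integrability of the wave profile).** Let `J ∈ C¹` be nonnegative, even, of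
mass 1, with `J' ∈ L¹` and finite first moment, and let `f ∈ C¹` satisfy `f(0) = f(1) = 0`,
`f'(0) < 0`, `f'(1) < 0`.  If `(c, U)` is a monotone differentiable traveling wave profile
with `0 ≤ U ≤ 1`, `U(-∞) = 0`, `U(+∞) = 1` solving `J ∗ U - U - c U' + f(U) = 0`, then
`∫_{-∞}^0 U < ∞` and `∫_0^{+∞} (1 - U) < ∞`. -/
theorem wave_integrability
    (J f U : ℝ → ℝ) (c : ℝ)
    (hJC1 : ContDiff ℝ 1 J) (hJpos : ∀ x, 0 ≤ J x) (hJeven : ∀ x, J (-x) = J x)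
    (hJint : Integrable J) (hJmass : (∫ x, J x) = 1)
    (hJ' : Integrable (deriv J))
    (hJmom : Integrable (fun y => |y| * J y))
    (hfC1 : ContDiff ℝ 1 f)
    (hf0 : f 0 = 0) (hf1 : f 1 = 0)
    (hf'0 : deriv f 0 < 0) (hf'1 : deriv f 1 < 0)
    (hUmono : Monotone U) (hUdiff : Differentiable ℝ U)
    (hU01 : ∀ x, U x ∈ Set.Icc (0:ℝ) 1)
    (hUbot : Tendsto U atBot (nhds 0))
    (hUtop : Tendsto U atTop (nhds 1))
    (hTW : ∀ x, (∫ y, J y * U (x - y)) - U x - c * deriv U x + f (U x) = 0) :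
    IntegrableOn U (Set.Iic 0) ∧ IntegrableOn (fun x => 1 - U x) (Set.Ici 0) := by
  refine ⟨wave_left J f U c hJC1.continuous hJpos hJint hJmass hJmom
    (hfC1.differentiable one_ne_zero 0) hf0 hf'0 hUmono hUdiff hU01 hUbot hTW, ?_⟩
  have hUc : Continuous U := hUdiff.continuous
  have hfd := (hfC1.differentiable one_ne_zero 1).hasDerivAt
  have hg : HasDerivAt (fun u => - f (1 - u)) (deriv f 1) 0 := by
    have h1 : HasDerivAt (fun u : ℝ => 1 - u) (-1) 0 := by
      simpa using (hasDerivAt_id (0:ℝ)).const_sub 1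
    have h2 : HasDerivAt f (deriv f 1) (1 - 0) := by simpa using hfd
    have h3 := (h2.comp (0:ℝ) h1).neg
    rw [mul_neg, mul_one, neg_neg] at h3
    exact h3
  have hV : ∀ x, HasDerivAt (fun x => 1 - U (-x)) (deriv U (-x)) x := fun x => by
    simpa using (((hUdiff (-x)).hasDerivAt).comp x (hasDerivAt_neg x)).const_sub 1
  have key := wave_left J (fun u => - f (1 - u)) (fun x => 1 - U (-x)) (-c)
    hJC1.continuous hJpos hJint hJmass hJmom hg.differentiableAt (by simp [hf1])
    (by rw [hg.deriv]; exact hf'1)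
    (fun x y hxy => by
      have := hUmono (neg_le_neg hxy)
      simp only; linarith)
    (fun x => (hV x).differentiableAt)
    (fun x => ⟨by linarith [(hU01 (-x)).2], by linarith [(hU01 (-x)).1]⟩)
    (by simpa using (hUtop.comp tendsto_neg_atBot_atTop).const_sub 1)
    (fun x => by
      have hIJ : Integrable (fun y => J y * U (-x + y)) := by
        have hJc := hJC1.continuous
        refine hJint.mono (by fun_prop) (ae_of_all _ fun y => ?_)
        rw [norm_mul]
        refine mul_le_of_le_one_right (norm_nonneg _) ?_
        rw [Real.norm_eq_abs, abs_of_nonneg (hU01 _).1]; exact (hU01 _).2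
      have e : (∫ y, J y * (1 - U (-(x - y)))) = 1 - ∫ y, J y * U (-x - y) := by
        have e1 : (∫ y, J y * U (-x - y)) = ∫ y, J y * U (-x + y) := by
          rw [← integral_neg_eq_self]
          simp [hJeven]
        rw [e1, ← hJmass, ← integral_sub hJint hIJ, hJmass]
        congr 1; ext y
        rw [show -(x - y) = -x + y by ring]; ring
      rw [e, (hV x).deriv, show (1:ℝ) - (1 - U (-x)) = U (-x) by ring]
      linarith [hTW (-x)])
  have := key.comp_neg
  simpa using this
end
end

section
/- Let J satisfy (K1), J not identically zero, and assume there exists λ₀ > 0 with ∫_ℝ e^{λ₀ x} J(x) dx < ∞. Define the logarithmic moment generating function Λ(λ) := ln(∫_ℝ e^{λx} J(x) dx) (with values in (−∞, +∞]) and its Fenchel–Legendre transform Λ*(x) := sup_{λ∈ℝ} (λx − Λ(λ)). Then: (a) Λ* is nondecreasing on (0,+∞); (b) there exists L₁ > 0 such that Λ*(L) < +∞ for all L ∈ [0, L₁]; and (c) for every 0 < L₀ < L₁, one has (1/i)·ln R_i(iL) → −Λ*(L) as i → ∞, uniformly for L ∈ [L₀, L₁], i.e. lim_{i→∞} sup_{L∈[L₀,L₁]}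 |(1/i)·ln R_i(iL) + Λ*(L)| = 0. -/
open MeasureTheory Filter Set Asymptotics

noncomputable section

/-- The logarithmic moment generating function `Λ(λ) = ln ∫ e^{λx} J(x) dx`, valued in
`(-∞, +∞]` (as an extended real). -/
def mgfLog (J : ℝ → ℝ) (lam : ℝ) : EReal :=
  ENNReal.log (∫⁻ x : ℝ, ENNReal.ofReal (Real.exp (lam * x) * J x))

/-- The Fenchel–Legendre transform `Λ*(x) = sup_{λ ∈ ℝ} (λ x - Λ(λ))`. -/
def fenchel (J : ℝ → ℝ) (x : ℝ) : EReal :=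
  ⨆ lam : ℝ, ((lam * x : ℝ) : EReal) - mgfLog J lam


/-- real mgf -/
def mgfF (J : ℝ → ℝ) (l : ℝ) : ℝ := ∫ x, Real.exp (l * x) * J x

lemma convIter_nonneg {J : ℝ → ℝ} (h : ∀ x, 0 ≤ J x) (n : ℕ) : ∀ x, 0 ≤ convIter J n x := by
  induction n with
  | zero => exact h
  | succ n ih =>
    intro x
    exact integral_nonneg fun y => mul_nonneg (h y) (ih _)

lemma convIter_int {J : ℝ → ℝ} (h : Integrable J) (n : ℕ) :
    Integrable (convIter J n) ∧ ∫ x, convIter J n x = (∫ x, J x) ^ (n + 1) := by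
  induction n with
  | zero => exact ⟨h, by simp [convIter]⟩
  | succ n ih =>
    refine ⟨Integrable.integrable_convolution (ContinuousLinearMap.mul ℝ ℝ) h ih.1, ?_⟩
    have := integral_convolution (μ := volume) (ν := volume)
      (ContinuousLinearMap.mul ℝ ℝ) h ih.1
    rw [pow_succ', ← ih.2]
    exact this

lemma convIter_tilt (J : ℝ → ℝ) (l : ℝ) (n : ℕ) : ∀ x,
    convIter (fun x => Real.exp (l * x) * J x) n x = Real.exp (l * x) * convIter J n x := by
  induction n with
  | zero => intro x; rfl
  | succ n ih =>
    intro x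
    simp only [convIter]
    rw [← integral_const_mul]
    refine integral_congr_ae (Eventually.of_forall fun y => ?_)
    simp only [ih]
    have : Real.exp (l * x) = Real.exp (l * y) * Real.exp (l * (x - y)) := by
      rw [← Real.exp_add]; ring_nf
    rw [this]; ring

lemma tilt_int {J : ℝ → ℝ} {l : ℝ} (h : Integrable (fun x => Real.exp (l * x) * J x)) (n : ℕ) :
    Integrable (fun x => Real.exp (l * x) * convIter J n x) ∧
      ∫ x, Real.exp (l * x) * convIter J n x = (mgfF J l) ^ (n + 1) := by
  have := convIter_int h n
  have e : convIter (fun x => Real.exp (l * x) * J x) n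
      = fun x => Real.exp (l * x) * convIter J n x := funext (convIter_tilt J l n)
  rw [e] at this
  exact this

lemma tilt_neg {J : ℝ → ℝ} (he : ∀ x, J (-x) = J x) {l : ℝ}
    (h : Integrable (fun x => Real.exp (l * x) * J x)) :
    Integrable (fun x => Real.exp (-l * x) * J x) := by
  have := h.comp_neg
  refine this.congr (Eventually.of_forall fun x => ?_)
  simp [he]

lemma mgfF_neg {J : ℝ → ℝ} (he : ∀ x, J (-x) = J x) (l : ℝ) : mgfF J (-l) = mgfF J l := by
  unfold mgfF
  rw [← integral_neg_eq_self]
  simp [he]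

lemma mgfLog_neg {J : ℝ → ℝ} (he : ∀ x, J (-x) = J x) (l : ℝ) : mgfLog J (-l) = mgfLog J l := by
  unfold mgfLog
  congr 1
  have := (Measure.measurePreserving_neg (volume : Measure ℝ)).lintegral_comp_emb
    (MeasurableEquiv.neg ℝ).measurableEmbedding
    (fun x : ℝ => ENNReal.ofReal (Real.exp (l * x) * J x))
  rw [← this]
  simp [he]

lemma fenchel_mono {J : ℝ → ℝ} (he : ∀ x, J (-x) = J x) :
    MonotoneOn (fenchel J) (Set.Ioi 0) := by
  intro x hx y hy hxy
  simp only [Set.mem_Ioi] at hx hy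
  refine iSup_le fun l => ?_
  have h1 : mgfLog J |l| = mgfLog J l := by
    rcases abs_choice l with h | h <;> rw [h]
    exact mgfLog_neg he l
  refine le_trans ?_ (le_iSup _ |l|)
  rw [h1]
  refine EReal.sub_le_sub ?_ le_rfl
  norm_cast
  exact mul_le_mul (le_abs_self l) hxy hx.le (abs_nonneg l)

lemma mgfLog_eq {J : ℝ → ℝ} (h0 : ∀ x, 0 ≤ J x) {l : ℝ}
    (h : Integrable (fun x => Real.exp (l * x) * J x)) (hp : 0 < mgfF J l) :
    mgfLog J l = ((Real.log (mgfF J l) : ℝ) : EReal) := by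
  unfold mgfLog
  rw [← ofReal_integral_eq_lintegral_ofReal h
    (Eventually.of_forall fun x => mul_nonneg (Real.exp_pos _).le (h0 x))]
  exact ENNReal.log_ofReal_of_pos hp

lemma mgfLog_top {J : ℝ → ℝ} (h0 : ∀ x, 0 ≤ J x) (hJ : Integrable J) {l : ℝ}
    (h : ¬ Integrable (fun x => Real.exp (l * x) * J x)) :
    mgfLog J l = ⊤ := by
  unfold mgfLog
  rw [ENNReal.log_eq_top_iff]
  by_contra hne
  apply h
  refine ⟨(Continuous.aestronglyMeasurable (by fun_prop)).mul hJ.1, ?_⟩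
  rw [hasFiniteIntegral_iff_ofReal
    (Eventually.of_forall fun x => mul_nonneg (Real.exp_pos _).le (h0 x))]
  exact lt_top_iff_ne_top.mpr hne

lemma one_le_mgfF {J : ℝ → ℝ} (h : K1 J) {l : ℝ}
    (hi : Integrable (fun x => Real.exp (l * x) * J x)) : 1 ≤ mgfF J l := by
  obtain ⟨h0, he, hJ, h1⟩ := h
  have hn := tilt_neg he hi
  have e : mgfF J l + mgfF J (-l) = ∫ x, (Real.exp (l * x) * J x + Real.exp (-l * x) * J x) :=
    (integral_add hi hn).symm
  have : ∫ x, 2 * J x ≤ ∫ x, (Real.exp (l * x) * J x + Real.exp (-l * x) * J x) := by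
    refine integral_mono (hJ.const_mul 2) (hi.add hn) fun x => ?_
    have h1 := Real.add_one_le_exp (l * x)
    have h2 := Real.add_one_le_exp (-l * x)
    have h3 := h0 x
    simp only
    nlinarith
  rw [integral_const_mul, h1, ← e, mgfF_neg he] at this
  linarith

lemma tail_upper {J : ℝ → ℝ} (h : K1 J) {l : ℝ}
    (hi : Integrable (fun x => Real.exp (l * x) * J x)) (n : ℕ) {T : ℝ} (hT : 0 ≤ T) :
    tailR J n T ≤ 2 * (Real.exp (-(l * T)) * mgfF J l ^ (n + 1)) := by
  obtain ⟨h0, he, hJ, h1⟩ := h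
  have hn := tilt_neg he hi
  obtain ⟨a1, a2⟩ := tilt_int hi n
  obtain ⟨b1, b2⟩ := tilt_int hn n
  rw [mgfF_neg he] at b2
  have hms : MeasurableSet {x : ℝ | T ≤ |x|} := measurableSet_le measurable_const (by fun_prop)
  unfold tailR
  rw [← integral_indicator hms]
  have : ∫ x, ({x : ℝ | T ≤ |x|}.indicator (convIter J n) x) ≤
      ∫ x, (Real.exp (-(l * T)) * (Real.exp (l * x) * convIter J n x) +
        Real.exp (-(l * T)) * (Real.exp (-l * x) * convIter J n x)) := by
    refine integral_mono ((convIter_int hJ n).1.indicator hms)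
      ((a1.const_mul _).add (b1.const_mul _)) fun x => ?_
    have hg := convIter_nonneg h0 n x
    have p1 := Real.exp_pos (l * x - l * T)
    have p2 := Real.exp_pos (-l * x - l * T)
    have e1 : Real.exp (-(l * T)) * (Real.exp (l * x) * convIter J n x) =
      Real.exp (l * x - l * T) * convIter J n x := by
      rw [← mul_assoc, ← Real.exp_add]; ring_nf
    have e2 : Real.exp (-(l * T)) * (Real.exp (-l * x) * convIter J n x) =
      Real.exp (-l * x - l * T) * convIter J n x := by
      rw [← mul_assoc, ← Real.exp_add]; ring_nf
    simp only [e1, e2]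
    by_cases hx : T ≤ |x|
    · rw [Set.indicator_of_mem (by exact hx), ← add_mul]
      refine le_mul_of_one_le_left hg ?_
      have : 0 ≤ l * x - l * T ∨ 0 ≤ -l * x - l * T := by
        by_contra! hc
        have h1 : |l * x| < l * T := abs_lt.mpr ⟨by linarith [hc.2], by linarith [hc.1]⟩
        rw [abs_mul] at h1
        have h2 : l * T ≤ |l| * T := mul_le_mul_of_nonneg_right (le_abs_self l) hT
        have h3 : |l| * T ≤ |l| * |x| := mul_le_mul_of_nonneg_left hx (abs_nonneg l)
        linarith
      rcases this with h | h
      · have := Real.one_le_exp h; linarith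
      · have := Real.one_le_exp h; linarith
    · rw [Set.indicator_of_notMem (by exact hx)]
      positivity
  rw [integral_add (a1.const_mul _) (b1.const_mul _), integral_const_mul, integral_const_mul,
    a2, b2] at this
  linarith

lemma tail_lower {J : ℝ → ℝ} (h : K1 J) {l η : ℝ} (hl : 0 ≤ l) (hη : 0 ≤ η)
    (hi : Integrable (fun x => Real.exp (l * x) * J x))
    (hi1 : Integrable (fun x => Real.exp ((l + η) * x) * J x))
    (hi2 : Integrable (fun x => Real.exp ((l - η) * x) * J x))
    (n : ℕ) {S T : ℝ} :
    Real.exp (-(l * T)) * (mgfF J l ^ (n + 1) - Real.exp (-(η * T)) * mgfF J (l + η) ^ (n + 1)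
      - Real.exp (η * S) * mgfF J (l - η) ^ (n + 1)) ≤ tailR J n S := by
  obtain ⟨h0, he, hJ, h1⟩ := h
  obtain ⟨a1, a2⟩ := tilt_int hi n
  obtain ⟨b1, b2⟩ := tilt_int hi1 n
  obtain ⟨c1, c2⟩ := tilt_int hi2 n
  have hms : MeasurableSet {x : ℝ | S ≤ |x|} := measurableSet_le measurable_const (by fun_prop)
  have d1 : Integrable (fun x => Real.exp (l * x) * convIter J n x -
      Real.exp (-(η * T)) * (Real.exp ((l + η) * x) * convIter J n x)) :=
    a1.sub (b1.const_mul _)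
  unfold tailR
  rw [← integral_indicator hms]
  rw [← a2, ← b2, ← c2, ← integral_const_mul, ← integral_const_mul,
    ← integral_sub a1 (b1.const_mul _), ← integral_sub d1 (c1.const_mul _),
    ← integral_const_mul]
  refine integral_mono ((d1.sub (c1.const_mul _)).const_mul _)
    ((convIter_int hJ n).1.indicator hms) fun x => ?_
  have hg := convIter_nonneg h0 n x
  have e1 : Real.exp (-(η * T)) * (Real.exp ((l + η) * x) * convIter J n x) =
      Real.exp (l * x) * Real.exp (η * (x - T)) * convIter J n x := by
    rw [← mul_assoc, ← Real.exp_add, ← Real.exp_add]; ring_nf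
  have e2 : Real.exp (η * S) * (Real.exp ((l - η) * x) * convIter J n x) =
      Real.exp (l * x) * Real.exp (η * (S - x)) * convIter J n x := by
    rw [← mul_assoc, ← Real.exp_add, ← Real.exp_add]; ring_nf
  simp only [e1, e2]
  have e3 : Real.exp (-(l * T)) * (Real.exp (l * x) * convIter J n x -
      Real.exp (l * x) * Real.exp (η * (x - T)) * convIter J n x -
      Real.exp (l * x) * Real.exp (η * (S - x)) * convIter J n x)
      = (Real.exp (l * (x - T)) * (1 - Real.exp (η * (x - T)) - Real.exp (η * (S - x))))
        * convIter J n x := by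
    have : Real.exp (l * (x - T)) = Real.exp (-(l * T)) * Real.exp (l * x) := by
      rw [← Real.exp_add]; ring_nf
    rw [this]; ring
  rw [e3]
  have p0 := Real.exp_pos (l * (x - T))
  have p1 := Real.exp_pos (η * (x - T))
  have p2 := Real.exp_pos (η * (S - x))
  have hind : 0 ≤ {x : ℝ | S ≤ |x|}.indicator (convIter J n) x :=
    Set.indicator_nonneg (fun y _ => convIter_nonneg h0 n y) x
  by_cases hT : T < x
  · refine le_trans ?_ hind
    have := Real.one_le_exp (mul_nonneg hη (sub_nonneg.mpr hT.le))
    refine mul_nonpos_of_nonpos_of_nonneg (mul_nonpos_of_nonneg_of_nonpos p0.le ?_) hg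
    linarith
  · by_cases hS : x < S
    · refine le_trans ?_ hind
      have := Real.one_le_exp (mul_nonneg hη (sub_nonneg.mpr hS.le))
      refine mul_nonpos_of_nonpos_of_nonneg (mul_nonpos_of_nonneg_of_nonpos p0.le ?_) hg
      linarith
    · push Not at hT hS
      rw [Set.indicator_of_mem (by exact hS.trans (le_abs_self x))]
      refine mul_le_of_le_one_left hg ?_
      have : Real.exp (l * (x - T)) ≤ 1 :=
        Real.exp_le_one_iff.mpr (mul_nonpos_of_nonneg_of_nonpos hl (by linarith))
      nlinarith

lemma exp_two (t : ℝ) : Real.exp t ≤ 1 + t + t ^ 2 * Real.exp |t| := by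
  have := Complex.norm_exp_sub_sum_le_norm_mul_exp (t : ℂ) 2
  simp only [Finset.sum_range_succ, Finset.sum_range_zero] at this
  have e : Complex.exp t - (0 + (t : ℂ) ^ 0 / (Nat.factorial 0 : ℂ) + (t : ℂ) ^ 1 / (Nat.factorial 1 : ℂ))
      = ((Real.exp t - (1 + t) : ℝ) : ℂ) := by
    push_cast; simp
  rw [e, Complex.norm_real, Complex.norm_real, Real.norm_eq_abs, Real.norm_eq_abs, sq_abs] at this
  linarith [le_abs_self (Real.exp t - (1 + t))]

/-- first tilted moment -/
def meanF (J : ℝ → ℝ) (l : ℝ) : ℝ := ∫ x, x * (Real.exp (l * x) * J x)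

/-- dominating weight -/
def wE (a x : ℝ) : ℝ := Real.exp (a * x) + Real.exp (-a * x)

lemma exp_le_wE {a x : ℝ} (ha : 0 < a) {s : ℝ} (hs : s ≤ a * |x|) : Real.exp s ≤ wE a x := by
  refine (Real.exp_le_exp.mpr hs).trans ?_
  unfold wE
  rcases abs_choice x with h | h <;> rw [h]
  · linarith [Real.exp_pos (-a * x)]
  · rw [show a * -x = -a * x by ring]; linarith [Real.exp_pos (a * x)]

lemma mul_exp_le {a x : ℝ} (ha : 0 < a) {s : ℝ} (hs : s ≤ 3 / 4 * a * |x|) :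
    |x| * Real.exp s ≤ 4 / a * wE a x := by
  have h1 : Real.exp (a / 4 * |x|) * Real.exp s ≤ wE a x := by
    rw [← Real.exp_add]; exact exp_le_wE ha (by linarith)
  have h2 := Real.add_one_le_exp (a / 4 * |x|)
  have h3 : |x| ≤ 4 / a * Real.exp (a / 4 * |x|) := by
    have : |x| = 4 / a * (a / 4 * |x|) := by field_simp
    rw [this]
    have : a / 4 * (4 / a * (a / 4 * |x|)) = a / 4 * |x| := by field_simp
    rw [this]
    gcongr; linarith
  calc |x| * Real.exp s ≤ 4 / a * Real.exp (a / 4 * |x|) * Real.exp s := by gcongr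
    _ = 4 / a * (Real.exp (a / 4 * |x|) * Real.exp s) := by ring
    _ ≤ _ := by gcongr

lemma sq_mul_exp_le {a x : ℝ} (ha : 0 < a) {s : ℝ} (hs : s ≤ 3 / 4 * a * |x|) :
    x ^ 2 * Real.exp s ≤ 32 / a ^ 2 * wE a x := by
  have h1 : Real.exp (a / 4 * |x|) * Real.exp s ≤ wE a x := by
    rw [← Real.exp_add]; exact exp_le_wE ha (by linarith)
  have h2 := Real.quadratic_le_exp_of_nonneg (x := a / 4 * |x|) (by positivity)
  have h3 : x ^ 2 ≤ 32 / a ^ 2 * Real.exp (a / 4 * |x|) := by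
    have e : x ^ 2 = 32 / a ^ 2 * ((a / 4 * |x|) ^ 2 / 2) := by
      rw [mul_pow, sq_abs]; field_simp; ring
    rw [e]
    gcongr
    have : 0 ≤ a / 4 * |x| := by positivity
    linarith
  calc x ^ 2 * Real.exp s ≤ 32 / a ^ 2 * Real.exp (a / 4 * |x|) * Real.exp s := by gcongr
    _ = 32 / a ^ 2 * (Real.exp (a / 4 * |x|) * Real.exp s) := by ring
    _ ≤ _ := by gcongr

lemma wE_int {J : ℝ → ℝ} (h : K1 J) {a : ℝ}
    (hexp : Integrable (fun x => Real.exp (a * x) * J x)) :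
    Integrable (fun x => wE a x * J x) := by
  refine (hexp.add (tilt_neg h.2.1 hexp)).congr (Eventually.of_forall fun x => ?_)
  simp only [wE, Pi.add_apply]; ring

lemma mul_le_abs' {l a x : ℝ} (hl : |l| ≤ a) : l * x ≤ a * |x| := by
  refine (le_abs_self _).trans ?_
  rw [abs_mul]; gcongr

lemma tilt_integrable {J : ℝ → ℝ} (h : K1 J) {a : ℝ} (ha : 0 < a)
    (hexp : Integrable (fun x => Real.exp (a * x) * J x)) {l : ℝ} (hl : |l| ≤ a) :
    Integrable (fun x => Real.exp (l * x) * J x) := by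
  refine (wE_int h hexp).mono'
    ((Continuous.aestronglyMeasurable (by fun_prop)).mul h.2.2.1.1) ?_
  refine Eventually.of_forall fun x => ?_
  have h0 := h.1 x
  rw [Real.norm_eq_abs, abs_of_nonneg (mul_nonneg (Real.exp_pos _).le h0)]
  gcongr
  exact exp_le_wE ha (mul_le_abs' hl)

lemma mean_bound {J : ℝ → ℝ} (h : K1 J) {a : ℝ} (ha : 0 < a) {l : ℝ} (hl : |l| ≤ 3 / 4 * a)
    (x : ℝ) : ‖x * (Real.exp (l * x) * J x)‖ ≤ 4 / a * (wE a x * J x) := by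
  have h0 := h.1 x
  rw [norm_mul, Real.norm_eq_abs, Real.norm_eq_abs,
    abs_of_nonneg (mul_nonneg (Real.exp_pos _).le h0), ← mul_assoc, ← mul_assoc]
  exact mul_le_mul_of_nonneg_right (mul_exp_le ha (mul_le_abs' hl)) h0

lemma mean_integrable {J : ℝ → ℝ} (h : K1 J) {a : ℝ} (ha : 0 < a)
    (hexp : Integrable (fun x => Real.exp (a * x) * J x)) {l : ℝ} (hl : |l| ≤ 3 / 4 * a) :
    Integrable (fun x => x * (Real.exp (l * x) * J x)) :=
  ((wE_int h hexp).const_mul (4 / a)).mono'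
    ((Continuous.aestronglyMeasurable (by fun_prop)).mul
      ((Continuous.aestronglyMeasurable (by fun_prop)).mul h.2.2.1.1))
    (Eventually.of_forall (mean_bound h ha hl))

lemma meanF_cont {J : ℝ → ℝ} (h : K1 J) {a : ℝ} (ha : 0 < a)
    (hexp : Integrable (fun x => Real.exp (a * x) * J x)) :
    ContinuousOn (meanF J) (Set.Icc 0 (a / 2)) := by
  refine continuousOn_of_dominated (bound := fun x => 4 / a * (wE a x * J x)) ?_ ?_
    ((wE_int h hexp).const_mul _) ?_
  · intro l _
    exact ((Continuous.aestronglyMeasurable (by fun_prop)).mul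
      ((Continuous.aestronglyMeasurable (by fun_prop)).mul h.2.2.1.1))
  · intro l hl
    refine Eventually.of_forall (mean_bound h ha ?_)
    rw [abs_of_nonneg hl.1]; linarith [hl.2]
  · exact Eventually.of_forall fun x => by fun_prop

lemma mgfF_cont {J : ℝ → ℝ} (h : K1 J) {a : ℝ} (ha : 0 < a)
    (hexp : Integrable (fun x => Real.exp (a * x) * J x)) :
    ContinuousOn (mgfF J) (Set.Icc 0 (a / 2)) := by
  refine continuousOn_of_dominated (bound := fun x => wE a x * J x) ?_ ?_
    (wE_int h hexp) ?_
  · intro l _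
    exact ((Continuous.aestronglyMeasurable (by fun_prop)).mul h.2.2.1.1)
  · intro l hl
    refine Eventually.of_forall fun x => ?_
    have h0 := h.1 x
    rw [Real.norm_eq_abs, abs_of_nonneg (mul_nonneg (Real.exp_pos _).le h0)]
    gcongr
    refine exp_le_wE ha (mul_le_abs' ?_)
    rw [abs_of_nonneg hl.1]; linarith [hl.2]
  · exact Eventually.of_forall fun x => by fun_prop

lemma meanF_zero {J : ℝ → ℝ} (h : K1 J) : meanF J 0 = 0 := by
  have : meanF J 0 = - meanF J 0 := by
    conv_lhs => unfold meanF
    rw [← integral_neg_eq_self]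
    unfold meanF
    rw [← integral_neg]
    simp [h.2.1]
  linarith

lemma meanF_pos {J : ℝ → ℝ} (h : K1 J) {a : ℝ} (ha : 0 < a)
    (hexp : Integrable (fun x => Real.exp (a * x) * J x)) {l : ℝ} (hl0 : 0 < l)
    (hl : l ≤ 3 / 4 * a) : 0 < meanF J l := by
  have i1 := mean_integrable h ha hexp (l := l) (by rwa [abs_of_pos hl0])
  have i0 := mean_integrable h ha hexp (l := 0) (by rw [abs_zero]; positivity)
  have e : meanF J l = ∫ x, (x * (Real.exp (l * x) * J x) - x * (Real.exp (0 * x) * J x)) := by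
    rw [integral_sub i1 i0]
    have := meanF_zero h
    unfold meanF at this ⊢
    rw [this, sub_zero]
  have e2 : ∀ x, x * (Real.exp (l * x) * J x) - x * (Real.exp (0 * x) * J x)
      = x * (Real.exp (l * x) - 1) * J x := fun x => by simp; ring
  have pos : ∀ x, x ≠ 0 → 0 < x * (Real.exp (l * x) - 1) := by
    intro x hx
    rcases lt_or_gt_of_ne hx with h | h
    · exact mul_pos_of_neg_of_neg h (by
        have := Real.exp_lt_one_iff.mpr (mul_neg_of_pos_of_neg hl0 h); linarith)
    · exact mul_pos h (by
        have := Real.one_lt_exp_iff.mpr (mul_pos hl0 h); linarith)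
  have nn : ∀ x, 0 ≤ x * (Real.exp (l * x) * J x) - x * (Real.exp (0 * x) * J x) := by
    intro x
    rw [e2]
    refine mul_nonneg ?_ (h.1 x)
    rcases eq_or_ne x 0 with rfl | hx
    · simp
    · exact (pos x hx).le
  rw [e]
  refine lt_of_le_of_ne (integral_nonneg nn) fun hz => ?_
  have hz' := (integral_eq_zero_iff_of_nonneg nn (i1.sub i0)).mp hz.symm
  have hJ0 : J =ᵐ[volume] 0 := by
    filter_upwards [hz', Measure.ae_ne volume (0 : ℝ)] with x hx hx0
    rw [Pi.zero_apply, e2] at hx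
    rcases mul_eq_zero.mp hx with h | h
    · exact absurd h (pos x hx0).ne'
    · exact h
  have := integral_congr_ae hJ0
  rw [h.2.2.2] at this
  simp at this

lemma mgfF_second {J : ℝ → ℝ} (h : K1 J) {a : ℝ} (ha : 0 < a)
    (hexp : Integrable (fun x => Real.exp (a * x) * J x)) {l η : ℝ} (hl : |l| ≤ a / 2)
    (hη : |η| ≤ a / 4) :
    mgfF J (l + η) ≤ mgfF J l + η * meanF J l + (32 / a ^ 2 * ∫ x, wE a x * J x) * η ^ 2 := by
  have i0 := tilt_integrable h ha hexp (l := l) (by linarith)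
  have i1 := mean_integrable h ha hexp (l := l) (by linarith)
  have i2 := tilt_integrable h ha hexp (l := l + η) (by linarith [abs_add_le l η])
  have iw := (wE_int h hexp).const_mul (32 / a ^ 2 * η ^ 2)
  have i3 : Integrable (fun x => Real.exp (l * x) * J x + η * (x * (Real.exp (l * x) * J x))) :=
    i0.add (i1.const_mul η)
  have key : mgfF J (l + η) ≤ ∫ x, ((Real.exp (l * x) * J x + η * (x * (Real.exp (l * x) * J x)))
      + 32 / a ^ 2 * η ^ 2 * (wE a x * J x)) := by
    refine integral_mono i2 (i3.add iw) fun x => ?_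
    have h0 := h.1 x
    have h1 := exp_two (η * x)
    have h2 := sq_mul_exp_le (a := a) (x := x) ha (s := l * x + |η * x|) (by
      have : l * x ≤ a / 2 * |x| := mul_le_abs' hl
      have : |η * x| ≤ a / 4 * |x| := by rw [abs_mul]; gcongr
      linarith)
    have h3 : Real.exp ((l + η) * x) ≤ Real.exp (l * x) * (1 + η * x)
        + 32 / a ^ 2 * η ^ 2 * wE a x := by
      calc Real.exp ((l + η) * x) = Real.exp (l * x) * Real.exp (η * x) := by
            rw [← Real.exp_add]; ring_nf
        _ ≤ Real.exp (l * x) * (1 + η * x + (η * x) ^ 2 * Real.exp |η * x|) := by gcongr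
        _ = Real.exp (l * x) * (1 + η * x) + η ^ 2 * (x ^ 2 * Real.exp (l * x + |η * x|)) := by
            rw [Real.exp_add]; ring
        _ ≤ Real.exp (l * x) * (1 + η * x) + η ^ 2 * (32 / a ^ 2 * wE a x) := by gcongr
        _ = _ := by ring
    have := mul_le_mul_of_nonneg_right h3 h0
    simp only
    linarith
  rw [integral_add i3 iw, integral_add i0 (i1.const_mul η), integral_const_mul,
    integral_const_mul] at key
  unfold mgfF meanF at *
  linarith

lemma exists_tilt {J : ℝ → ℝ} (h : K1 J) {a : ℝ} (ha : 0 < a)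
    (hexp : Integrable (fun x => Real.exp (a * x) * J x)) {c : ℝ} (hc : 0 ≤ c)
    (hc2 : c ≤ meanF J (a / 2) / mgfF J (a / 2)) :
    ∃ l ∈ Set.Icc 0 (a / 2), meanF J l = c * mgfF J l := by
  have hcont : ContinuousOn (fun l => meanF J l - c * mgfF J l) (Set.Icc 0 (a / 2)) :=
    (meanF_cont h ha hexp).sub (continuousOn_const.mul (mgfF_cont h ha hexp))
  have F0 : mgfF J 0 = 1 := by simp [mgfF, h.2.2.2]
  have F1 := one_le_mgfF h (tilt_integrable h ha hexp (l := a / 2) (by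
    rw [abs_of_pos (by positivity)]; linarith))
  rw [le_div_iff₀ (by linarith)] at hc2
  obtain ⟨l, hl, hle⟩ := intermediate_value_Icc (by positivity) hcont
    (show (0 : ℝ) ∈ Set.Icc _ _ from ⟨by simp [F0, meanF_zero h, hc], by simpa using hc2⟩)
  exact ⟨l, hl, by simp only at hle; linarith⟩

lemma lower_core {J : ℝ → ℝ} (h : K1 J) {a : ℝ} (ha : 0 < a)
    (hexp : Integrable (fun x => Real.exp (a * x) * J x)) {ε : ℝ} (hε : 0 < ε) :
    ∃ q, 0 ≤ q ∧ q < 1 ∧ ∀ l ∈ Set.Icc 0 (a / 2), ∀ c, meanF J l = c * mgfF J l → ∀ n : ℕ,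
      Real.exp (-(l * ((n + 1 : ℕ) * (c + ε / 2)))) * (mgfF J l ^ (n + 1) * (1 - 2 * q ^ (n + 1)))
        ≤ tailR J n ((n + 1 : ℕ) * (c - ε / 2)) := by
  set C := 32 / a ^ 2 * ∫ x, wE a x * J x with hC
  have hC0 : 0 ≤ C := by
    refine mul_nonneg (by positivity) (integral_nonneg fun x => mul_nonneg ?_ (h.1 x))
    unfold wE; positivity
  set η := min (a / 4) (ε / (4 * (C + 1))) with hη
  have η0 : 0 < η := lt_min (by positivity) (by positivity)
  have η1 : η ≤ a / 4 := min_le_left _ _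
  have η2 : C * η ≤ ε / 4 := by
    have : η ≤ ε / (4 * (C + 1)) := min_le_right _ _
    rw [le_div_iff₀ (by positivity)] at this
    nlinarith
  refine ⟨Real.exp (-(η * (ε / 2)) + C * η ^ 2), (Real.exp_pos _).le, ?_, ?_⟩
  · rw [Real.exp_lt_one_iff]
    have : C * η ^ 2 ≤ ε / 4 * η := by nlinarith
    have : 0 < η * ε := by positivity
    linarith
  intro l hl c hc n
  have hla : |l| ≤ a / 2 := by rw [abs_of_nonneg hl.1]; exact hl.2
  have hηa : |η| ≤ a / 4 := by rwa [abs_of_pos η0]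
  have hηa' : |-η| ≤ a / 4 := by rwa [abs_neg]
  have i0 := tilt_integrable h ha hexp (l := l) (by linarith)
  have i1 := tilt_integrable h ha hexp (l := l + η) (by linarith [abs_add_le l η])
  have i2 := tilt_integrable h ha hexp (l := l + -η) (by linarith [abs_add_le l (-η)])
  have F1 := one_le_mgfF h i0
  have s1 := mgfF_second h ha hexp hla hηa
  have s2 := mgfF_second h ha hexp hla hηa'
  rw [← hC, hc] at s1 s2
  have b1 : mgfF J (l + η) ≤ mgfF J l * Real.exp (η * c + C * η ^ 2) := by
    have := Real.add_one_le_exp (η * c + C * η ^ 2)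
    have := mul_le_mul_of_nonneg_left this (by linarith : 0 ≤ mgfF J l)
    have : 0 ≤ C * η ^ 2 := by positivity
    nlinarith
  have b2 : mgfF J (l + -η) ≤ mgfF J l * Real.exp (-η * c + C * η ^ 2) := by
    have := Real.add_one_le_exp (-η * c + C * η ^ 2)
    have := mul_le_mul_of_nonneg_left this (by linarith : 0 ≤ mgfF J l)
    have : 0 ≤ C * η ^ 2 := by positivity
    nlinarith
  have p1 := one_le_mgfF h i1
  have p2 := one_le_mgfF h i2
  have key := tail_lower h hl.1 η0.le i0 i1 i2 n (S := (n + 1 : ℕ) * (c - ε / 2))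
    (T := (n + 1 : ℕ) * (c + ε / 2))
  refine le_trans ?_ key
  gcongr
  have t1 : Real.exp (-(η * ((n + 1 : ℕ) * (c + ε / 2)))) * mgfF J (l + η) ^ (n + 1) ≤
      mgfF J l ^ (n + 1) * Real.exp (-(η * (ε / 2)) + C * η ^ 2) ^ (n + 1) := by
    calc _ ≤ Real.exp (-(η * ((n + 1 : ℕ) * (c + ε / 2)))) *
          (mgfF J l * Real.exp (η * c + C * η ^ 2)) ^ (n + 1) := by gcongr
      _ = mgfF J l ^ (n + 1) * (Real.exp (-(η * ((n + 1 : ℕ) * (c + ε / 2)))) *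
          Real.exp (η * c + C * η ^ 2) ^ (n + 1)) := by rw [mul_pow]; ring
      _ = _ := by
        rw [← Real.exp_nat_mul, ← Real.exp_nat_mul, ← Real.exp_add]
        congr 2; ring
  have t2 : Real.exp (η * ((n + 1 : ℕ) * (c - ε / 2))) * mgfF J (l + -η) ^ (n + 1) ≤
      mgfF J l ^ (n + 1) * Real.exp (-(η * (ε / 2)) + C * η ^ 2) ^ (n + 1) := by
    calc _ ≤ Real.exp (η * ((n + 1 : ℕ) * (c - ε / 2))) *
          (mgfF J l * Real.exp (-η * c + C * η ^ 2)) ^ (n + 1) := by gcongr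
      _ = mgfF J l ^ (n + 1) * (Real.exp (η * ((n + 1 : ℕ) * (c - ε / 2))) *
          Real.exp (-η * c + C * η ^ 2) ^ (n + 1)) := by rw [mul_pow]; ring
      _ = _ := by
        rw [← Real.exp_nat_mul, ← Real.exp_nat_mul, ← Real.exp_add]
        congr 2; ring
  rw [← sub_eq_add_neg] at t2
  linarith

lemma core {J : ℝ → ℝ} (h : K1 J) {a : ℝ} (ha : 0 < a)
    (hexp : Integrable (fun x => Real.exp (a * x) * J x)) {L₂ : ℝ} (hL2 : 0 < L₂)
    (hL2' : L₂ = meanF J (a / 2) / mgfF J (a / 2)) {δ : ℝ} (hδ : 0 < δ) :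
    ∃ N : ℕ, ∀ i : ℕ, N ≤ i → ∀ L ∈ Set.Icc 0 (L₂ / 2), fenchel J L ≠ ⊤ ∧
      |(1 / (i : ℝ)) * Real.log (tailR J (i - 1) ((i : ℝ) * L)) + (fenchel J L).toReal| ≤ δ := by
  set ε := min L₂ (δ / a) with hε
  have ε0 : 0 < ε := lt_min hL2 (by positivity)
  have ε1 : ε ≤ L₂ := min_le_left _ _
  have ε2 : ε * a ≤ δ := by
    have : ε ≤ δ / a := min_le_right _ _
    rwa [le_div_iff₀ ha] at this
  obtain ⟨q, q0, q1, hq⟩ := lower_core h ha hexp ε0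
  have ev1 : ∀ᶠ i : ℕ in atTop, q ^ i < 1 / 4 :=
    (tendsto_pow_atTop_nhds_zero_of_lt_one q0 q1).eventually_lt_const (by norm_num)
  have ev2 : ∀ᶠ i : ℕ in atTop, Real.log 2 / (i : ℝ) < δ / 2 :=
    (tendsto_const_div_atTop_nhds_zero_nat (Real.log 2)).eventually_lt_const (by positivity)
  obtain ⟨N, hN⟩ := eventually_atTop.mp ((ev1.and ev2).and (eventually_ge_atTop 1))
  refine ⟨N, fun i hi L hL => ?_⟩
  obtain ⟨⟨e1, e2⟩, e3⟩ := hN i hi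
  obtain ⟨n, rfl⟩ : ∃ n, i = n + 1 := ⟨i - 1, by omega⟩
  rw [Nat.add_sub_cancel]
  obtain ⟨l, hl, hle⟩ := exists_tilt h ha hexp (c := L + ε / 2) (by linarith [hL.1])
    (by rw [← hL2']; linarith [hL.2])
  have low := hq l hl _ hle n
  rw [show L + ε / 2 - ε / 2 = L by ring, show L + ε / 2 + ε / 2 = L + ε by ring] at low
  have i0 := tilt_integrable h ha hexp (l := l) (by rw [abs_of_nonneg hl.1]; linarith [hl.2])
  have F1 := one_le_mgfF h i0
  have hi0 : (0 : ℝ) < ((n + 1 : ℕ) : ℝ) := by positivity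
  generalize hm : ((n + 1 : ℕ) : ℝ) = m at *
  set R := tailR J n (m * L) with hR
  have low2 : Real.exp (-(l * (m * (L + ε)))) * (mgfF J l ^ (n + 1) * (1 / 2)) ≤ R := by
    refine le_trans ?_ low
    gcongr
    linarith
  have Fp : 0 < mgfF J l := by linarith
  have Rpos : 0 < R := lt_of_lt_of_le (by positivity) low2
  have low3 : -(l * (m * (L + ε))) + m * Real.log (mgfF J l) - Real.log 2 ≤ Real.log R := by
    have := Real.log_le_log (by positivity) low2
    rw [Real.log_mul (by positivity) (by positivity), Real.log_exp,
      Real.log_mul (by positivity) (by positivity), Real.log_pow, hm, one_div, Real.log_inv] at this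
    linarith
  have up : fenchel J L ≤ (((Real.log 2 - Real.log R) / m : ℝ) : EReal) := by
    refine iSup_le fun k => ?_
    by_cases hk : Integrable (fun x => Real.exp (k * x) * J x)
    · have K1' := one_le_mgfF h hk
      have Kp : 0 < mgfF J k := by linarith
      rw [mgfLog_eq h.1 hk Kp]
      norm_cast
      rw [le_div_iff₀ hi0]
      have := Real.log_le_log Rpos (tail_upper h hk n (mul_nonneg hi0.le hL.1))
      rw [Real.log_mul (by positivity) (by positivity), Real.log_mul (by positivity) (by positivity),
        Real.log_exp, Real.log_pow, hm] at this
      linarith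
    · rw [mgfLog_top h.1 h.2.2.1 hk, EReal.sub_top]
      exact bot_le
  have dn : ((l * L - Real.log (mgfF J l) : ℝ) : EReal) ≤ fenchel J L := by
    refine le_trans ?_ (le_iSup _ l)
    rw [mgfLog_eq h.1 i0 Fp]
    norm_cast
  have nt : fenchel J L ≠ ⊤ := ne_top_of_le_ne_top (EReal.coe_ne_top _) up
  have nb : fenchel J L ≠ ⊥ := ne_bot_of_le_ne_bot (EReal.coe_ne_bot _) dn
  refine ⟨nt, ?_⟩
  rw [← EReal.coe_toReal nt nb, EReal.coe_le_coe_iff] at up dn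
  generalize (fenchel J L).toReal = f at *
  have low4 : -(l * (L + ε)) + Real.log (mgfF J l) - Real.log 2 / m ≤ Real.log R / m := by
    rw [le_div_iff₀ hi0]
    have : Real.log 2 / m * m = Real.log 2 := by field_simp
    nlinarith
  rw [sub_div] at up
  have : l * ε ≤ δ / 2 := by nlinarith [hl.2]
  rw [one_div_mul_eq_div, abs_le]
  constructor <;> linarith

/-- **Lemma (uniform Cramér large deviations estimate).** Let `J` be a nontrivial kernel
satisfying (K1), exponentially bounded (`∫ e^{λ₀ x} J < ∞` for some `λ₀ > 0`).  Then `Λ*` is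
nondecreasing on `(0, ∞)`; there is `L₁ > 0` with `Λ*(L) < +∞` for all `L ∈ [0, L₁]`; and for
every `0 < L₀ < L₁`, `(1/i) ln R_i(iL) → -Λ*(L)` as `i → ∞`, uniformly for
`L ∈ [L₀, L₁]`. -/
theorem cramer_uniform
    (J : ℝ → ℝ) (lam0 : ℝ)
    (hK1 : K1 J) (hJne : ∃ x, J x ≠ 0)
    (hlam0 : 0 < lam0)
    (hexp : Integrable (fun x => Real.exp (lam0 * x) * J x)) :
    MonotoneOn (fenchel J) (Set.Ioi 0) ∧
    ∃ L₁ > 0, (∀ L ∈ Set.Icc (0:ℝ) L₁, fenchel J L ≠ ⊤) ∧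
      ∀ L₀, 0 < L₀ → L₀ < L₁ →
        ∀ δ, 0 < δ → ∃ N : ℕ, ∀ i : ℕ, N ≤ i → ∀ L ∈ Set.Icc L₀ L₁,
          |(1 / (i : ℝ)) * Real.log (tailR J (i - 1) ((i : ℝ) * L)) + (fenchel J L).toReal|
            ≤ δ := by
  obtain ⟨h0, he, hJ, h1⟩ := id hK1
  have hp := meanF_pos hK1 hlam0 hexp (l := lam0 / 2) (by positivity) (by linarith)
  have hF := one_le_mgfF hK1 (tilt_integrable hK1 hlam0 hexp (l := lam0 / 2) (by
    rw [abs_of_pos (by positivity)]; linarith))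
  have hL2 : 0 < meanF J (lam0 / 2) / mgfF J (lam0 / 2) := div_pos hp (by linarith)
  refine ⟨fenchel_mono he, meanF J (lam0 / 2) / mgfF J (lam0 / 2) / 2, by positivity, ?_, ?_⟩
  · intro L hL
    obtain ⟨N, hN⟩ := core hK1 hlam0 hexp hL2 rfl one_pos
    exact (hN N le_rfl L hL).1
  · intro L₀ hL0 _ δ hδ
    obtain ⟨N, hN⟩ := core hK1 hlam0 hexp hL2 rfl hδ
    exact ⟨N, fun i hi L hL => (hN i hi L ⟨hL0.le.trans hL.1, hL.2⟩).2⟩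
end
end
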